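/- For every integer n ≥ 3 there exist a Ważewski dendrite X of order n and a finitely generated subgroup G of Homeo(X), dense in Homeo(X), such that: (i) every finite subgroup H of G has order whose prime divisors are all at most n, and if n is prime then n² does not divide the order of H; and (ii) conversely, for every positive integer m all of whose prime divisors are at most n and such that n² does not divide m when n is prime, G contains an abelian subgroup of order m. -/

import Mathlib

open Topology

/-- The set of connected components of a subset `S` of `X`. -/
def setComponents (X : Type*) [TopologicalSpace X] (S : Set X) : Set (Set X) :=
  {C | ∃ x ∈ S, C = connectedComponentIn S x}

/-- The order of a point `p` of `X`: the number of connected components of `X \ {p}`. -/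
noncomputable def ptOrder (X : Type*) [TopologicalSpace X] (p : X) : ℕ :=
  (setComponents X {p}ᶜ).ncard

/-- A dendrite: a nonempty, compact, connected, locally connected metrizable space
containing no subspace homeomorphic to the circle. -/
def IsDendrite (X : Type*) [TopologicalSpace X] : Prop :=
  Nonempty X ∧ CompactSpace X ∧ ConnectedSpace X ∧ LocallyConnectedSpace X ∧
    TopologicalSpace.MetrizableSpace X ∧
    ∀ S : Set X, IsEmpty (S ≃ₜ Circle)

/-- A Ważewski dendrite of order `n`: a dendrite all of whose points have order `1`, `2`
or `n`, and every arc (subspace homeomorphic to `[0,1]`) contains a point of order `n`. -/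
def IsWazewskiDendrite (n : ℕ) (X : Type*) [TopologicalSpace X] : Prop :=
  IsDendrite X ∧
  (∀ p : X, ptOrder X p = 1 ∨ ptOrder X p = 2 ∨ ptOrder X p = n) ∧
  ∀ A : Set X, Nonempty (A ≃ₜ unitInterval) → ∃ p ∈ A, ptOrder X p = n

/-- The group structure on self-homeomorphisms of `X`, with composition as product. -/
instance Homeomorph.instGroupSelf (X : Type*) [TopologicalSpace X] : Group (X ≃ₜ X) where
  mul f g := g.trans f
  one := Homeomorph.refl X
  inv := Homeomorph.symm
  mul_assoc _ _ _ := rfl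
  one_mul _ := Homeomorph.ext fun _ => rfl
  mul_one _ := Homeomorph.ext fun _ => rfl
  inv_mul_cancel := Homeomorph.self_trans_symm

/-- The compact-open topology on the group of self-homeomorphisms of `X` (for compact
metric `X`, this is the topology of uniform convergence). -/
instance Homeomorph.instTopSelf (X : Type*) [TopologicalSpace X] :
    TopologicalSpace (X ≃ₜ X) :=
  TopologicalSpace.induced (fun h : X ≃ₜ X => (h : C(X, X))) ContinuousMap.compactOpen

open Topology

namespace Waz

noncomputable section

/-- Infinite words over `N+3` letters. -/
abbrev W (N : ℕ) := ℕ → Fin (N + 3)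

section model
variable {N : ℕ}

def wcons (i : Fin (N + 3)) (x : W N) : W N := fun k => Nat.casesOn k i x
def wtl (x : W N) : W N := fun k => x (k + 1)
def wb : W N := fun _ => 1
def wa : W N := wcons 0 wb

lemma wcons_wtl (x : W N) : wcons (x 0) (wtl x) = x := by
  funext k; cases k <;> rfl

lemma wtl_wcons (i : Fin (N + 3)) (x : W N) : wtl (wcons i x) = x := rfl

lemma wcons_wb : wcons 1 (wb : W N) = wb := by
  funext k; cases k <;> rfl

/-- Sign of a letter. -/
def sg (i : Fin (N + 3)) : ℝ := if i = 0 then -1 else if i = 1 then 1 else 0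

lemma abs_sg (i : Fin (N + 3)) : |sg i| ≤ 1 := by
  unfold sg; split_ifs <;> norm_num

def Tterm (x : W N) (k : ℕ) : ℝ := (1/2)^(k+1) * ∏ l ∈ Finset.range k, sg (x l)

lemma Tterm_bound (k : ℕ) (x : W N) : ‖Tterm x k‖ ≤ (1/2)^k := by
  unfold Tterm
  rw [norm_mul, norm_prod]
  have h1 : ∏ l ∈ Finset.range k, ‖sg (x l)‖ ≤ 1 :=
    Finset.prod_le_one (fun _ _ => norm_nonneg _) (fun i _ => abs_sg _)
  have h2 : ‖((1:ℝ)/2)^(k+1)‖ ≤ (1/2)^k := by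
    rw [norm_pow, pow_succ]; norm_num
  calc _ ≤ ((1:ℝ)/2)^k * 1 := by
        apply mul_le_mul h2 h1 (Finset.prod_nonneg fun _ _ => norm_nonneg _) (by positivity)
    _ = _ := mul_one _

lemma summable_half : Summable (fun k : ℕ => ((1:ℝ)/2)^k) :=
  summable_geometric_of_lt_one (by norm_num) (by norm_num)

lemma summable_Tterm (x : W N) : Summable (Tterm x) :=
  Summable.of_norm_bounded summable_half (fun k => Tterm_bound k x)

/-- Projection to the main arc, as a real number. -/
def T (x : W N) : ℝ := ∑' k, Tterm x k

lemma continuous_T : Continuous (T : W N → ℝ) := by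
  refine continuous_tsum (fun k => ?_) summable_half Tterm_bound
  unfold Tterm
  refine continuous_const.mul (continuous_finsetProd _ fun l _ => ?_)
  exact (continuous_of_discreteTopology (f := (sg : Fin (N+3) → ℝ))).comp (continuous_apply l)

lemma T_cons (i : Fin (N + 3)) (x : W N) : T (wcons i x) = (1 + sg i * T x) / 2 := by
  unfold T
  rw [(summable_Tterm (wcons i x)).tsum_eq_zero_add]
  have h : ∀ k, Tterm (wcons i x) (k+1) = (sg i / 2) * Tterm x k := by
    intro k
    unfold Tterm
    rw [Finset.prod_range_succ']
    have : ∀ l, wcons i x (l+1) = x l := fun l => rfl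
    have h0 : wcons i x 0 = i := rfl
    simp only [this, h0]
    ring
  simp only [h, tsum_mul_left]
  simp [Tterm]; ring

lemma T_wb : T (wb : W N) = 1 := by
  have h := T_cons 1 (wb : W N)
  rw [wcons_wb] at h
  simp [sg] at h
  linarith

lemma T_wa : T (wa : W N) = 0 := by
  unfold wa; rw [T_cons, T_wb]; simp [sg]

/-- Retraction to a first level cell, on words. -/
def wR (i : Fin (N + 3)) (x : W N) : W N := if x 0 = i then wtl x else wa

lemma continuous_wtl : Continuous (wtl : W N → W N) :=
  continuous_pi fun k => continuous_apply (k + 1)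

lemma continuous_wcons (i : Fin (N + 3)) : Continuous (wcons i : W N → W N) := by
  refine continuous_pi fun k => ?_
  cases k
  · exact continuous_const
  · exact continuous_apply _

lemma continuous_wR (i : Fin (N + 3)) : Continuous (wR i : W N → W N) := by
  unfold wR
  refine Continuous.if ?_ continuous_wtl continuous_const
  intro x hx
  have : IsClopen {x : W N | x 0 = i} :=
    (isClopen_discrete ({i} : Set (Fin (N+3)))).preimage (continuous_apply 0)
  rw [this.frontier_eq] at hx
  exact hx.elim

def phi : W N → List (Fin (N + 3)) → ℝ
  | x, [] => T x
  | x, i :: w => phi (wR i x) w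

lemma continuous_phi : Continuous (phi : W N → List (Fin (N + 3)) → ℝ) := by
  refine continuous_pi fun w => ?_
  induction w with
  | nil => exact continuous_T
  | cons i w ih => exact ih.comp (continuous_wR i)

end model

/-- The model of the Wazewski dendrite of order `N+3`. -/
def X (N : ℕ) : Type := Set.range (phi : W N → List (Fin (N + 3)) → ℝ)

instance (N : ℕ) : TopologicalSpace (X N) := instTopologicalSpaceSubtype
instance (N : ℕ) : T2Space (X N) :=
  inferInstanceAs (T2Space (Set.range (phi : W N → List (Fin (N + 3)) → ℝ)))
instance (N : ℕ) : SecondCountableTopology (X N) :=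
  inferInstanceAs (SecondCountableTopology (Set.range (phi : W N → List (Fin (N + 3)) → ℝ)))
instance (N : ℕ) : CompactSpace (X N) :=
  isCompact_iff_compactSpace.mp (isCompact_range continuous_phi)
instance (N : ℕ) : TopologicalSpace.MetrizableSpace (X N) :=
  inferInstanceAs (TopologicalSpace.MetrizableSpace
    (Set.range (phi : W N → List (Fin (N + 3)) → ℝ)))

section api
variable {N : ℕ}

def qm (x : W N) : X N := ⟨phi x, x, rfl⟩
lemma continuous_qm : Continuous (qm : W N → X N) := continuous_phi.subtype_mk _
lemma qm_surj : Function.Surjective (qm : W N → X N) := by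
  rintro ⟨_, x, rfl⟩; exact ⟨x, rfl⟩

def fAmb (i : Fin (N + 3)) (p : List (Fin (N + 3)) → ℝ) : List (Fin (N + 3)) → ℝ
  | [] => (1 + sg i * p []) / 2
  | j :: w => if i = j then p w else phi wa w

lemma fAmb_phi (i : Fin (N + 3)) (x : W N) : fAmb i (phi x) = phi (wcons i x) := by
  funext w
  cases w with
  | nil => simp only [fAmb, phi]; rw [T_cons]
  | cons j w =>
    have h0 : wcons i x 0 = i := rfl
    simp only [fAmb, phi, wR, h0, wtl_wcons]
    split_ifs <;> rfl

lemma continuous_fAmb (i : Fin (N + 3)) : Continuous (fAmb i) := by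
  refine continuous_pi fun w => ?_
  cases w with
  | nil => simp only [fAmb]; fun_prop
  | cons j w => simp only [fAmb]; split_ifs <;> fun_prop

/-- The cell maps. -/
def f (i : Fin (N + 3)) (p : X N) : X N :=
  ⟨fAmb i p.1, by obtain ⟨x, hx⟩ := p.2; exact ⟨wcons i x, by rw [← hx, fAmb_phi]⟩⟩

lemma f_qm (i : Fin (N + 3)) (x : W N) : f i (qm x) = qm (wcons i x) :=
  Subtype.ext (fAmb_phi i x)

lemma continuous_f (i : Fin (N + 3)) : Continuous (f i : X N → X N) :=
  ((continuous_fAmb i).comp continuous_subtype_val).subtype_mk _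

/-- The retractions. -/
def r (i : Fin (N + 3)) (p : X N) : X N :=
  ⟨fun w => p.1 (i :: w), by obtain ⟨x, hx⟩ := p.2; exact ⟨wR i x, by rw [← hx]; rfl⟩⟩

lemma r_qm (i : Fin (N + 3)) (x : W N) : r i (qm x) = qm (wR i x) := rfl

lemma continuous_r (i : Fin (N + 3)) : Continuous (r i : X N → X N) :=
  Continuous.subtype_mk (f := fun (p : X N) w => p.1 (i :: w))
    (continuous_pi fun w => (continuous_apply (i :: w)).comp continuous_subtype_val) _

def a : X N := qm wa
def b : X N := qm wb
def c : X N := f 0 a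

lemma f_zero_b : f 0 (b : X N) = a := f_qm _ _
lemma f_one_b : f 1 (b : X N) = b := by unfold b; rw [f_qm, wcons_wb]

lemma r_f (i : Fin (N + 3)) (p : X N) : r i (f i p) = p := by
  obtain ⟨x, rfl⟩ := qm_surj p
  rw [f_qm, r_qm]
  simp [wR, wcons, wtl_wcons]

lemma r_f_ne {i j : Fin (N + 3)} (h : j ≠ i) (p : X N) : r i (f j p) = a := by
  obtain ⟨x, rfl⟩ := qm_surj p
  rw [f_qm, r_qm]
  simp [wR, wcons, h]
  rfl

lemma f_a (i : Fin (N + 3)) : f i (a : X N) = c := by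
  apply Subtype.ext
  funext w
  change fAmb i (phi wa) w = fAmb 0 (phi wa) w
  cases w with
  | nil => simp [fAmb, phi, T_wa]
  | cons j w => simp [fAmb]

lemma exists_f (p : X N) : ∃ i y, p = f i y := by
  obtain ⟨x, rfl⟩ := qm_surj p
  exact ⟨x 0, qm (wtl x), by rw [f_qm, wcons_wtl]⟩

lemma a_ne_b : (a : X N) ≠ b := by
  intro h
  have h1 := congrFun (congrArg Subtype.val h) []
  have : T (wa : W N) = T wb := h1
  rw [T_wa, T_wb] at this
  norm_num at this

lemma f_inj (i : Fin (N + 3)) : Function.Injective (f i : X N → X N) :=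
  Function.LeftInverse.injective (r_f i)

lemma f_eq_ne {i j : Fin (N + 3)} (h : i ≠ j) {p q : X N} (e : f i p = f j q) :
    p = a ∧ q = a := by
  constructor
  · rw [← r_f i p, e, r_f_ne h.symm]
  · rw [← r_f j q, ← e, r_f_ne h]

lemma f_eq_c {i : Fin (N + 3)} {p : X N} : f i p = c ↔ p = a := by
  constructor
  · intro h; rw [← f_a i] at h; exact f_inj i h
  · rintro rfl; exact f_a i

lemma a_ne_c : (a : X N) ≠ c := by
  intro h; rw [← f_zero_b, f_eq_c] at h; exact a_ne_b h.symm

lemma b_ne_c : (b : X N) ≠ c := by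
  intro h; rw [← f_one_b, f_eq_c] at h; exact a_ne_b h.symm

/-- Iterated cell maps. -/
def fw : List (Fin (N + 3)) → X N → X N
  | [], p => p
  | i :: w, p => f i (fw w p)

lemma continuous_fw (w : List (Fin (N + 3))) : Continuous (fw w : X N → X N) := by
  induction w with
  | nil => exact continuous_id
  | cons i w ih => exact (continuous_f i).comp ih

def pre : W N → ℕ → List (Fin (N + 3))
  | _, 0 => []
  | x, k + 1 => x 0 :: pre (wtl x) k

lemma fw_pre (x y : W N) (k : ℕ) :
    ∃ z : W N, fw (pre x k) (qm y) = qm z ∧ ∀ j < k, z j = x j := by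
  induction k generalizing x with
  | zero => exact ⟨y, rfl, by simp⟩
  | succ k ih =>
    obtain ⟨z, hz, h⟩ := ih (wtl x)
    refine ⟨wcons (x 0) z, ?_, ?_⟩
    · simp only [pre, fw]; rw [hz, f_qm]
    · intro j hj
      cases j with
      | zero => rfl
      | succ j => exact h j (by omega)

lemma qm_mem (x : W N) (k : ℕ) : ∃ y, qm x = fw (pre x k) y := by
  induction k generalizing x with
  | zero => exact ⟨_, rfl⟩
  | succ k ih =>
    obtain ⟨y, hy⟩ := ih (wtl x)
    refine ⟨y, ?_⟩
    simp only [pre, fw]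
    rw [← hy, f_qm, wcons_wtl]

/-- Cells along a word shrink. -/
lemma shrink (x : W N) {U : Set (X N)} (hU : U ∈ 𝓝 (qm x)) :
    ∃ k, ∀ m ≥ k, Set.range (fw (pre x m)) ⊆ U := by
  have h := continuous_qm.continuousAt.preimage_mem_nhds hU
  rw [nhds_pi, Filter.mem_pi] at h
  obtain ⟨I, hI, t, ht, hs⟩ := h
  obtain ⟨k, hk⟩ := hI.bddAbove
  refine ⟨k + 1, fun m hm => ?_⟩
  rintro _ ⟨p, rfl⟩
  obtain ⟨y, rfl⟩ := qm_surj p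
  obtain ⟨z, hz, hj⟩ := fw_pre x y m
  rw [hz]
  apply hs
  intro i hi
  rw [hj i (by have := hk hi; omega)]
  exact mem_of_mem_nhds (ht i)

lemma eq_qm_of_mem (x : W N) (p : X N) (h : ∀ k, p ∈ Set.range (fw (pre x k))) : p = qm x := by
  by_contra hne
  obtain ⟨k, hk⟩ := shrink x (U := {p}ᶜ) (isOpen_compl_singleton.mem_nhds (Ne.symm hne))
  exact hk k le_rfl (h k) rfl

lemma pre_length (x : W N) (k : ℕ) : (pre x k).length = k := by
  induction k generalizing x with
  | zero => rfl
  | succ k ih => simp [pre, ih]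

end api
end
end Waz

open Topology

set_option linter.unusedSectionVars false
set_option linter.unusedVariables false

namespace Waz

section abstr
variable {Y : Type*} [TopologicalSpace Y]

/-- `x` and `y` lie in the same component of the complement of `z`. -/
def Same (z x y : Y) : Prop := y ∈ connectedComponentIn {z}ᶜ x

lemma Same.ne_left {z x y : Y} (h : Same z x y) : x ≠ z := by
  have : x ∈ ({z}ᶜ : Set Y) := connectedComponentIn_nonempty_iff.mp ⟨y, h⟩
  exact this

lemma Same.ne_right {z x y : Y} (h : Same z x y) : y ≠ z := by
  have : y ∈ ({z}ᶜ : Set Y) := connectedComponentIn_subset _ _ h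
  exact this

lemma Same.refl {z x : Y} (h : x ≠ z) : Same z x x :=
  mem_connectedComponentIn h

lemma Same.symm {z x y : Y} (h : Same z x y) : Same z y x := by
  unfold Same
  rw [← connectedComponentIn_eq h]
  exact Same.refl h.ne_left

lemma Same.trans {z x y w : Y} (h : Same z x y) (h' : Same z y w) : Same z x w := by
  unfold Same at *
  rw [connectedComponentIn_eq h]; exact h'

lemma Same.of_preconn {z x y : Y} {S : Set Y} (hS : IsPreconnected S) (hz : z ∉ S)
    (hx : x ∈ S) (hy : y ∈ S) : Same z x y :=
  hS.subset_connectedComponentIn hx (Set.subset_compl_singleton_iff.mpr hz) hy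

lemma same_iff_eq {z x y : Y} (hy : y ≠ z) : Same z x y ↔
    connectedComponentIn {z}ᶜ x = connectedComponentIn {z}ᶜ y := by
  constructor
  · intro h; exact connectedComponentIn_eq h
  · intro h; unfold Same; rw [h]; exact Same.refl hy

lemma Same.map {z x y : Y} {Z : Type*} [TopologicalSpace Z] {g : Y → Z} {z' : Z}
    (hg : Continuous g) (hz : ∀ w, g w = z' → w = z) (h : Same z x y) : Same z' (g x) (g y) := by
  refine Same.of_preconn (S := g '' connectedComponentIn {z}ᶜ x)
    (isPreconnected_connectedComponentIn.image _ hg.continuousOn) ?_ ⟨x, Same.refl h.ne_left, rfl⟩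
    ⟨y, h, rfl⟩
  rintro ⟨w, hw, e⟩
  exact connectedComponentIn_subset _ _ hw (hz w e)

lemma Same.homeo {z x y : Y} (h : Y ≃ₜ Y) (hs : Same z x y) : Same (h z) (h x) (h y) :=
  hs.map h.continuous fun _ e => h.injective e

lemma same_homeo_iff {z x y : Y} (h : Y ≃ₜ Y) : Same (h z) (h x) (h y) ↔ Same z x y := by
  refine ⟨fun hs => ?_, fun hs => hs.homeo h⟩
  have := hs.homeo h.symm
  simpa using this

/-- `z` separates `x` from `y`. -/
def Sp (z x y : Y) : Prop := x ≠ z ∧ y ≠ z ∧ ¬ Same z x y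

lemma Sp.symm {z x y : Y} (h : Sp z x y) : Sp z y x := ⟨h.2.1, h.1, fun hs => h.2.2 hs.symm⟩

lemma sp_homeo_iff {z x y : Y} (h : Y ≃ₜ Y) : Sp (h z) (h x) (h y) ↔ Sp z x y := by
  unfold Sp; rw [same_homeo_iff]; simp

variable [T2Space Y]

lemma isOpen_same [LocallyConnectedSpace Y] (z x : Y) : IsOpen {y | Same z x y} :=
  isOpen_compl_singleton.connectedComponentIn

lemma isClosed_same [LocallyConnectedSpace Y] (z x : Y) :
    IsClosed {y | y = z ∨ Same z x y} := by
  rw [← isOpen_compl_iff, isOpen_iff_mem_nhds]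
  intro y hy
  simp only [Set.mem_compl_iff, Set.mem_ofPred_eq, not_or] at hy
  refine Filter.mem_of_superset ((isOpen_same z y).mem_nhds (Same.refl hy.1)) ?_
  intro w hw
  simp only [Set.mem_compl_iff, Set.mem_ofPred_eq, not_or] at hw ⊢
  exact ⟨hw.ne_right, fun h => hy.2 (h.trans hw.symm)⟩

variable [LocallyConnectedSpace Y] [PreconnectedSpace Y]

lemma preconn_insert (z x : Y) (hx : x ≠ z) : IsPreconnected {y | y = z ∨ Same z x y} := by
  have hC : IsPreconnected {y | Same z x y} := isPreconnected_connectedComponentIn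
  refine hC.subset_closure (fun y hy => Or.inr hy) ?_
  rintro y (rfl | hy)
  · by_contra hz
    have hcl : closure {w | Same y x w} ⊆ {w | Same y x w} := by
      intro w hw
      refine Same.of_preconn hC.closure hz (subset_closure (Same.refl hx)) hw
    have : IsClopen {w | Same y x w} := ⟨isClosed_of_closure_subset hcl, isOpen_same y x⟩
    rcases isClopen_iff.mp this with h | h
    · have : x ∈ {w | Same y x w} := Same.refl hx
      rw [h] at this; exact this
    · have : y ∈ {w | Same y x w} := by rw [h]; trivial
      exact Same.ne_right this rfl
  · exact subset_closure hy

/-- The fundamental rule. -/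
lemma ruleT {z z' x : Y} (h : Sp z z' x) : Same z' z x := by
  refine Same.of_preconn (preconn_insert z x h.2.1) ?_ (Or.inl rfl) (Or.inr (Same.refl h.2.1))
  rintro (e | e)
  · exact h.1 e
  · exact h.2.2 e.symm

lemma Sp.ne {z x y : Y} (h : Sp z x y) : x ≠ y := by
  rintro rfl; exact h.2.2 (Same.refl h.1)

lemma Sp.trans {z z' y u : Y} (h : Sp z' y z) (h' : Sp z y u) : Sp z' y u := by
  have h1 : Same z z' y := ruleT h.symm
  have h2 : ¬ Same z z' u := fun hs => h'.2.2 (h1.symm.trans hs)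
  have hu : u ≠ z' := by rintro rfl; exact h'.2.2 h1.symm
  have h3 : Same z' z u := ruleT ⟨h1.ne_left, h'.2.1, h2⟩
  exact ⟨h.1, hu, fun hs => h.2.2 (hs.trans h3.symm)⟩

lemma Sp.compare {z z' y v : Y} (h : Sp z y v) (h' : Sp z' y v) :
    z = z' ∨ Sp z y z' ∨ Sp z' y z := by
  by_cases e : z = z'
  · exact Or.inl e
  refine Or.inr ?_
  by_cases hs : Same z' y z
  · left
    have h1 : Sp z' z v := ⟨hs.ne_right, h'.2.1, fun h2 => h'.2.2 (hs.trans h2)⟩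
    have h2 := ruleT h1
    exact ⟨h.1, h2.ne_left, fun h3 => h.2.2 (h3.trans h2)⟩
  · exact Or.inr ⟨h'.1, e, hs⟩

/-- Separation hypothesis. -/
def SEP (Y : Type*) [TopologicalSpace Y] : Prop := ∀ p q : Y, p ≠ q → ∃ z, Sp z p q

lemma germ2 (hY : SEP Y) {y u v : Y} (h : Same y u v) : ∃ z, Sp z y u ∧ Sp z y v := by
  let V : Set Y := {v | ∃ z, Sp z y u ∧ Sp z y v}
  have key : ∀ {z v v'}, Sp z y v → Same z v v' → Sp z y v' := fun h1 h2 =>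
    ⟨h1.1, h2.ne_right, fun h3 => h1.2.2 (h3.trans h2.symm)⟩
  have hV : IsOpen V := by
    rw [isOpen_iff_mem_nhds]
    rintro v ⟨z, h1, h2⟩
    refine Filter.mem_of_superset ((isOpen_same z v).mem_nhds (Same.refl h2.2.1)) ?_
    intro v' hv'
    exact ⟨z, h1, key h2 hv'⟩
  have hE : IsPreconnected {v | Same y u v} := isPreconnected_connectedComponentIn
  have hsub := hE.subset_of_closure_inter_subset hV ?_ ?_
  · exact hsub h
  · obtain ⟨z, hz⟩ := hY y u h.ne_left.symm
    exact ⟨u, Same.refl h.ne_left, z, hz, hz⟩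
  · rintro v ⟨hv, hE'⟩
    obtain ⟨z, hz⟩ := hY y v (Same.ne_right hE').symm
    rw [mem_closure_iff_nhds] at hv
    obtain ⟨v', hv', z', h1, h2⟩ := hv _ ((isOpen_same z v).mem_nhds (Same.refl hz.2.1))
    have hz' : Sp z y v' := key hz hv'
    rcases hz'.compare h2 with rfl | h3 | h3
    · exact ⟨z, h1, hz⟩
    · exact ⟨z, h3.trans h1, hz⟩
    · exact ⟨z', h1, h3.trans hz⟩

lemma germ (hY : SEP Y) {y u : Y} (hu : u ≠ y) (Z : Set Y) (hZ : Z.Finite)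
    (h : ∀ v ∈ Z, Same y u v) : ∃ z, Sp z y u ∧ ∀ v ∈ Z, Sp z y v := by
  induction Z, hZ using Set.Finite.induction_on with
  | empty =>
    obtain ⟨z, hz⟩ := hY y u hu.symm
    exact ⟨z, hz, by simp⟩
  | @insert v Z hv hZ ih =>
    obtain ⟨z, hz, hz'⟩ := ih fun v hv => h v (Set.mem_insert_of_mem _ hv)
    have h1 : Same y z u := ruleT hz
    have h2 : Same y z v := h1.trans (h v (Set.mem_insert _ _))
    obtain ⟨t, ht, ht'⟩ := germ2 hY h2
    refine ⟨t, ht.trans hz, ?_⟩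
    rintro w (rfl | hw)
    · exact ht'
    · exact ht.trans (hz' w hw)

/-- Convex sets. -/
def Cvx (K : Set Y) : Prop := ∀ x ∈ K, ∀ y ∈ K, ∀ z, Sp z x y → z ∈ K

/-- A finite set has an extreme point. -/
lemma exists_extreme (Z : Finset Y) (hZ : Z.Nonempty) :
    ∃ z ∈ Z, ∀ u ∈ Z, ∀ v ∈ Z, ¬ Sp z u v := by
  classical
  let m : Y × Y → ℕ := fun p => (Z.filter fun v => Same p.1 p.2 v).card
  obtain ⟨⟨z, e⟩, hz, hmax⟩ := Finset.exists_max_image (Z ×ˢ Z) m (hZ.product hZ)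
  rw [Finset.mem_product] at hz
  refine ⟨z, hz.1, ?_⟩
  have claim : ∀ v ∈ Z, v ≠ z → Same z e v := by
    intro v hv hvz
    by_contra hns
    have hlt : m (z, e) < m (v, z) := by
      apply Finset.card_lt_card
      rw [Finset.ssubset_iff_of_subset]
      · refine ⟨z, ?_, ?_⟩
        · simp only [Finset.mem_filter]; exact ⟨hz.1, Same.refl hvz.symm⟩
        · simp only [Finset.mem_filter, not_and]; intro _ h; exact h.ne_right rfl
      · intro w hw
        simp only [Finset.mem_filter] at hw ⊢
        refine ⟨hw.1, ruleT ⟨hvz, hw.2.ne_right, fun h => hns (hw.2.trans h.symm)⟩⟩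
    exact absurd (hmax (v, z) (by simp [hv, hz.1])) (not_le.mpr hlt)
  intro u hu v hv h
  exact h.2.2 ((claim u hu h.1).symm.trans (claim v hv h.2.1))

variable [CompactSpace Y]

lemma iter_mem {h : Y ≃ₜ Y} {K : Set Y} (hinv : ∀ x ∈ K, h x ∈ K) {x : Y} (hx : x ∈ K) (i : ℕ) :
    h^[i] x ∈ K := by
  induction i with
  | zero => exact hx
  | succ i ih => rw [Function.iterate_succ_apply']; exact hinv _ ih

lemma sp_iter {h : Y ≃ₜ Y} {z x y : Y} (i : ℕ) : Sp (h^[i] z) (h^[i] x) (h^[i] y) ↔ Sp z x y := by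
  induction i with
  | zero => rfl
  | succ i ih => simp only [Function.iterate_succ_apply']; rw [sp_homeo_iff, ih]

/-- The finite orbit. -/
def orb (h : Y ≃ₜ Y) (m : ℕ) (x : Y) : Set Y := (fun i => h^[i] x) '' Set.Iio m

lemma orb_finite (h : Y ≃ₜ Y) (m : ℕ) (x : Y) : (orb h m x).Finite :=
  (Set.finite_Iio m).image _

lemma iter_mod {h : Y ≃ₜ Y} {m : ℕ} (hm : ∀ x, h^[m] x = x) (i : ℕ) (x : Y) :
    h^[i % m] x = h^[i] x := by
  have : Function.IsPeriodicPt h m x := hm x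
  exact this.iterate_mod_apply i

lemma mem_orb {h : Y ≃ₜ Y} {m : ℕ} (h0 : 0 < m) (hm : ∀ x, h^[m] x = x) (i : ℕ) (x : Y) :
    h^[i] x ∈ orb h m x := ⟨i % m, Nat.mod_lt _ h0, iter_mod hm i x⟩

lemma orb_inv {h : Y ≃ₜ Y} {m : ℕ} (h0 : 0 < m) (hm : ∀ x, h^[m] x = x) (x : Y) :
    ∀ y ∈ orb h m x, h y ∈ orb h m x := by
  rintro _ ⟨i, _, rfl⟩
  have := mem_orb h0 hm (i + 1) x
  rwa [Function.iterate_succ_apply'] at this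

lemma orb_back {h : Y ≃ₜ Y} {m : ℕ} (h0 : 0 < m) (hm : ∀ x, h^[m] x = x) {x z u : Y}
    (hz : z ∈ orb h m x) (hu : u ∈ orb h m x) : ∃ j, h^[j] u = z := by
  obtain ⟨i, hi, rfl⟩ := hz
  obtain ⟨j, hj, rfl⟩ := hu
  refine ⟨i + (m - j), ?_⟩
  simp only [Set.mem_Iio] at hj
  simp only
  rw [← Function.iterate_add_apply, show i + (m - j) + j = i + m by omega,
    Function.iterate_add_apply, hm]

lemma orb_extreme {h : Y ≃ₜ Y} {m : ℕ} (h0 : 0 < m) (hm : ∀ x, h^[m] x = x) (x : Y) :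
    ∀ z ∈ orb h m x, ∀ u ∈ orb h m x, ∀ v ∈ orb h m x, ¬ Sp z u v := by
  obtain ⟨e, he, hext⟩ := exists_extreme (orb_finite h m x).toFinset
    ⟨x, by simpa using mem_orb h0 hm 0 x⟩
  simp only [Set.Finite.mem_toFinset] at he hext
  intro z hz u hu v hv hs
  obtain ⟨j, hj⟩ := orb_back h0 hm he hz
  refine hext (h^[j] u) (iter_mem (orb_inv h0 hm x) hu j) (h^[j] v)
    (iter_mem (orb_inv h0 hm x) hv j) ?_
  rw [← hj, sp_iter]; exact hs

/-- Fixed point theorem for finite order homeomorphisms. -/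
lemma exists_fixed (hY : SEP Y) {h : Y ≃ₜ Y} {m : ℕ} (h0 : 0 < m) (hm : ∀ x, h^[m] x = x)
    (K : Set Y) (hK : IsClosed K) (hne : K.Nonempty) (hcv : Cvx K) (hinv : ∀ x ∈ K, h x ∈ K) :
    ∃ p ∈ K, h p = p := by
  let S : Set (Set Y) := {K | IsClosed K ∧ K.Nonempty ∧ Cvx K ∧ ∀ x ∈ K, h x ∈ K}
  obtain ⟨M, hMK, hM⟩ := zorn_superset_nonempty S (by
    intro c hcS hch hcne
    refine ⟨⋂₀ c, ⟨?_, ?_, ?_, ?_⟩, fun s hs => Set.sInter_subset_of_mem hs⟩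
    · exact isClosed_sInter fun s hs => (hcS hs).1
    · have : Nonempty c := hcne.to_subtype
      rw [Set.sInter_eq_iInter]
      refine IsCompact.nonempty_iInter_of_directed_nonempty_isCompact_isClosed _ ?_
        (fun s => (hcS s.2).2.1) (fun s => (hcS s.2).1.isCompact) (fun s => (hcS s.2).1)
      rintro ⟨s, hs⟩ ⟨t, ht⟩
      rcases hch.total hs ht with hst | hst
      · exact ⟨⟨s, hs⟩, le_rfl, hst⟩
      · exact ⟨⟨t, ht⟩, hst, le_rfl⟩
    · intro x hx y hy z hz s hs
      exact (hcS hs).2.2.1 x (hx s hs) y (hy s hs) z hz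
    · intro x hx s hs
      exact (hcS hs).2.2.2 x (hx s hs)) K ⟨hK, hne, hcv, hinv⟩
  obtain ⟨hMc, hMne, hMcv, hMinv⟩ := hM.prop
  by_contra hcon
  push Not at hcon
  have hcon' : ∀ p ∈ M, h p ≠ p := fun p hp => hcon p (hMK hp)
  obtain ⟨p, hp⟩ := hMne
  obtain ⟨z, hz⟩ := hY p (h p) (hcon' p hp).symm
  have hzM : z ∈ M := hMcv p hp (h p) (hMinv p hp) z hz
  have hZM : ∀ y ∈ orb h m z, y ∈ M := by
    rintro _ ⟨i, _, rfl⟩; exact iter_mem hMinv hzM i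
  have hZe := orb_extreme h0 hm z
  -- reference direction
  have hdir : ∀ z1 ∈ orb h m z, h z1 ∈ orb h m z ∧ h z1 ≠ z1 := fun z1 h1 =>
    ⟨orb_inv h0 hm z z1 h1, hcon' z1 (hZM z1 h1)⟩
  let M' : Set Y := M ∩ ⋂ z1 ∈ orb h m z, {x | x = z1 ∨ Same z1 (h z1) x}
  have hM' : M' ∈ S := by
    refine ⟨?_, ?_, ?_, ?_⟩
    · exact hMc.inter (isClosed_biInter fun z1 _ => isClosed_same _ _)
    · refine ⟨z, hzM, ?_⟩
      simp only [Set.mem_iInter]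
      intro z1 h1
      by_cases e : z = z1
      · exact Or.inl e
      · right
        by_contra hs
        exact hZe z1 h1 (h z1) (hdir z1 h1).1 z (mem_orb h0 hm 0 z) ⟨(hdir z1 h1).2, e, hs⟩
    · intro x hx y hy w hw
      refine ⟨hMcv x hx.1 y hy.1 w hw, ?_⟩
      simp only [Set.mem_iInter]
      intro z1 h1
      have hx1 := Set.mem_iInter₂.mp hx.2 z1 h1
      have hy1 := Set.mem_iInter₂.mp hy.2 z1 h1
      simp only [Set.mem_ofPred_eq] at hx1 hy1 ⊢
      by_contra hcon2
      push Not at hcon2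
      obtain ⟨hwz, hws⟩ := hcon2
      have aux : ∀ t, (t = z1 ∨ Same z1 (h z1) t) → Same w z1 t := by
        rintro t (rfl | ht)
        · exact Same.refl hwz.symm
        · exact ruleT ⟨hwz, ht.ne_right, fun h2 => hws (ht.trans h2.symm)⟩
      exact hw.2.2 ((aux x hx1).symm.trans (aux y hy1))
    · intro x hx
      refine ⟨hMinv x hx.1, ?_⟩
      simp only [Set.mem_iInter]
      intro z1 h1
      have : h^[m - 1] z1 ∈ orb h m z := iter_mem (orb_inv h0 hm z) h1 _
      have he : h (h^[m-1] z1) = z1 := by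
        rw [← Function.iterate_succ_apply' h, Nat.succ_eq_add_one, Nat.sub_add_cancel h0, hm]
      have hx1 := Set.mem_iInter₂.mp hx.2 _ this
      rw [he] at hx1
      rcases hx1 with rfl | hx1
      · exact Or.inl he
      · right
        have := hx1.homeo h
        rwa [he] at this
  have hle : M ≤ M' := hM.le_of_le hM' Set.inter_subset_left
  have hzz := mem_orb h0 hm 0 z
  have h1 := Set.mem_iInter₂.mp (hle hp).2 z hzz
  have h2 := Set.mem_iInter₂.mp (hle (hMinv p hp)).2 z hzz
  rcases h1 with h1 | h1
  · exact hz.1 h1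
  rcases h2 with h2 | h2
  · exact hz.2.1 h2
  exact hz.2.2 (h1.symm.trans h2)

lemma eq_id_of_finite_order (hY : SEP Y) {h : Y ≃ₜ Y} {m : ℕ} (h0 : 0 < m)
    (hm : ∀ x, h^[m] x = x) (hp : ∀ p, h p = p → ∀ x, x ≠ p → Same p x (h x)) (x : Y) :
    h x = x := by
  let Z := orb h m x
  have hxZ : x ∈ Z := mem_orb h0 hm 0 x
  let H : Set Y := {y | y ∈ Z ∨ ∃ u ∈ Z, ∃ v ∈ Z, Sp y u v}
  have hnot : ∀ y, y ∉ H ↔ y ∉ Z ∧ ∀ u ∈ Z, Same y x u := by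
    intro y
    constructor
    · intro hy
      simp only [H, Set.mem_ofPred_eq, not_or, not_exists, not_and] at hy
      refine ⟨hy.1, fun u hu => ?_⟩
      by_contra hs
      exact hy.2 x hxZ u hu ⟨fun e => hy.1 (e ▸ hxZ), fun e => hy.1 (e ▸ hu), hs⟩
    · rintro ⟨h1, h2⟩ (h3 | ⟨u, hu, v, hv, h3⟩)
      · exact h1 h3
      · exact h3.2.2 ((h2 u hu).symm.trans (h2 v hv))
  have hHc : IsClosed H := by
    rw [← isOpen_compl_iff, isOpen_iff_mem_nhds]
    intro y hy
    obtain ⟨h1, h2⟩ := (hnot y).mp hy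
    obtain ⟨z, hz, hzZ⟩ := germ hY (y := y) (u := x) (fun e => h1 (e ▸ hxZ)) Z (orb_finite h m x) h2
    refine Filter.mem_of_superset ((isOpen_same z y).mem_nhds (Same.refl hz.1)) ?_
    intro y' hy'
    simp only [Set.mem_ofPred_eq] at hy'
    have aux : ∀ u ∈ Z, Same y' z u := fun u hu =>
      ruleT ⟨hy'.ne_right, (hzZ u hu).2.1, fun hs => (hzZ u hu).2.2 (hy'.trans hs)⟩
    refine (hnot y').mpr ⟨fun hm => (aux _ hm).ne_right rfl, fun u hu => ?_⟩
    exact (aux x hxZ).symm.trans (aux u hu)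
  have hHcv : Cvx H := by
    intro u hu v hv y hy
    by_contra hyH
    obtain ⟨h1, h2⟩ := (hnot y).mp hyH
    have aux : ∀ t ∈ H, t ≠ y → Same y x t := by
      rintro t (ht | ⟨u', hu', v', hv', hs⟩) hty
      · exact h2 t ht
      · by_contra hns
        have aux2 : ∀ s ∈ Z, Same t y s := fun s hs =>
          ruleT ⟨hty, (h2 s hs).ne_right, fun h3 => hns ((h2 s hs).trans h3.symm)⟩
        exact hs.2.2 ((aux2 u' hu').symm.trans (aux2 v' hv'))
    exact hy.2.2 ((aux u hu hy.1).symm.trans (aux v hv hy.2.1))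
  have hHinv : ∀ y ∈ H, h y ∈ H := by
    rintro y (hy | ⟨u, hu, v, hv, hs⟩)
    · exact Or.inl (orb_inv h0 hm x y hy)
    · exact Or.inr ⟨h u, orb_inv h0 hm x u hu, h v, orb_inv h0 hm x v hv, (sp_homeo_iff h).mpr hs⟩
  obtain ⟨p, hpH, hpp⟩ := exists_fixed hY h0 hm H hHc ⟨x, Or.inl hxZ⟩ hHcv hHinv
  by_cases hpZ : p ∈ Z
  · obtain ⟨j, hj⟩ := orb_back h0 hm hxZ hpZ
    rw [Function.iterate_fixed hpp] at hj
    rw [← hj]; exact hpp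
  · exfalso
    have aux : ∀ i, Same p x (h^[i] x) := by
      intro i
      induction i with
      | zero => exact Same.refl fun e => hpZ (e ▸ hxZ)
      | succ i ih =>
        rw [Function.iterate_succ_apply']
        exact ih.trans (hp p hpp _ ih.ne_right)
    refine (hnot p).mpr ⟨hpZ, ?_⟩ hpH
    rintro _ ⟨i, _, rfl⟩
    exact aux i

end abstr
end Waz

open Topology
set_option linter.unusedSectionVars false
set_option linter.unusedVariables false

namespace Waz

section top
variable {N : ℕ}

lemma isClosed_range_f (i : Fin (N + 3)) : IsClosed (Set.range (f i : X N → X N)) :=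
  (isCompact_range (continuous_f i)).isClosed

lemma isClosedMap_f (i : Fin (N + 3)) : IsClosedMap (f i : X N → X N) :=
  (continuous_f i).isClosedMap

instance : Nonempty (X N) := ⟨a⟩

instance : PreconnectedSpace (X N) := by
  rw [preconnectedSpace_iff_clopen]
  intro A hA
  by_contra hcon
  push Not at hcon
  let St := {A : Set (X N) // IsClopen A ∧ A ≠ ∅ ∧ A ≠ Set.univ}
  have step : ∀ s : St, ∃ (i : Fin (N + 3)), (f i ⁻¹' s.1) ≠ ∅ ∧ f i ⁻¹' s.1 ≠ Set.univ := by
    rintro ⟨A, hA, h1, h2⟩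
    obtain ⟨x, hx⟩ := Set.nonempty_iff_ne_empty.mpr h1
    obtain ⟨y, hy⟩ := (Set.ne_univ_iff_exists_notMem _).mp h2
    obtain ⟨i, x, rfl⟩ := exists_f x
    obtain ⟨j, y, rfl⟩ := exists_f y
    by_cases hc : c ∈ A
    · refine ⟨j, ?_, ?_⟩
      · rw [← Set.nonempty_iff_ne_empty]; exact ⟨a, by simpa [f_a] using hc⟩
      · rw [Set.ne_univ_iff_exists_notMem]; exact ⟨y, hy⟩
    · refine ⟨i, ?_, ?_⟩
      · rw [← Set.nonempty_iff_ne_empty]; exact ⟨x, hx⟩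
      · rw [Set.ne_univ_iff_exists_notMem]; exact ⟨a, by simpa [f_a] using hc⟩
  choose lab hlab using step
  let nxt : St → St := fun s => ⟨f (lab s) ⁻¹' s.1, s.2.1.preimage (continuous_f _), hlab s⟩
  let wd : St → W N := fun s k => lab (nxt^[k] s)
  have key : ∀ (k : ℕ) (s : St), fw (pre (wd s) k) ⁻¹' s.1 = (nxt^[k] s).1 := by
    intro k
    induction k with
    | zero => intro s; rfl
    | succ k ih =>
      intro s
      have h1 : wtl (wd s) = wd (nxt s) := rfl
      have h2 : fw (pre (wd s) (k+1)) ⁻¹' s.1 = fw (pre (wtl (wd s)) k) ⁻¹' (nxt s).1 := rfl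
      rw [h2, h1, ih]
      rfl
  let s0 : St := ⟨A, hA, hcon.1.ne_empty, hcon.2⟩
  by_cases hx : qm (wd s0) ∈ A
  · obtain ⟨k, hk⟩ := shrink (wd s0) (hA.2.mem_nhds hx)
    apply (nxt^[k] s0).2.2.2
    rw [← key k s0, Set.eq_univ_iff_forall]
    intro y; exact hk k le_rfl ⟨y, rfl⟩
  · obtain ⟨k, hk⟩ := shrink (wd s0) (hA.compl.2.mem_nhds hx)
    apply (nxt^[k] s0).2.2.1
    rw [← key k s0, Set.eq_empty_iff_forall_notMem]
    intro y hy; exact hk k le_rfl ⟨y, rfl⟩ hy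

instance : ConnectedSpace (X N) := { toNonempty := ⟨a⟩ }

lemma preconn_range_f (i : Fin (N + 3)) : IsPreconnected (Set.range (f i : X N → X N)) :=
  isPreconnected_range (continuous_f i)

lemma c_mem_range (i : Fin (N + 3)) : (c : X N) ∈ Set.range (f i) := ⟨a, f_a i⟩

/-- Coinduction principle for equality. -/
lemma coind (B : X N → X N → Prop)
    (hB : ∀ p q, B p q → ∃ i p' q', p = f i p' ∧ q = f i q' ∧ B p' q') {p q : X N} (h : B p q) :
    p = q := by
  let St := {s : X N × X N // B s.1 s.2}
  have step : ∀ s : St, ∃ (i : Fin (N + 3)) (s' : St), s.1.1 = f i s'.1.1 ∧ s.1.2 = f i s'.1.2 := by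
    rintro ⟨⟨p, q⟩, h⟩
    obtain ⟨i, p', q', h1, h2, h3⟩ := hB p q h
    exact ⟨i, ⟨⟨p', q'⟩, h3⟩, h1, h2⟩
  choose lab nxt h1 h2 using step
  let wd : St → W N := fun s k => lab (nxt^[k] s)
  have key : ∀ (k : ℕ) (s : St), s.1.1 ∈ Set.range (fw (pre (wd s) k)) ∧
      s.1.2 ∈ Set.range (fw (pre (wd s) k)) := by
    intro k
    induction k with
    | zero => intro s; exact ⟨⟨_, rfl⟩, ⟨_, rfl⟩⟩
    | succ k ih =>
      intro s
      obtain ⟨⟨y, hy⟩, ⟨z, hz⟩⟩ := ih (nxt s)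
      refine ⟨⟨y, ?_⟩, ⟨z, ?_⟩⟩
      · rw [h1 s, ← hy]; rfl
      · rw [h2 s, ← hz]; rfl
  let s0 : St := ⟨(p, q), h⟩
  have e1 := eq_qm_of_mem (wd s0) p fun k => (key k s0).1
  have e2 := eq_qm_of_mem (wd s0) q fun k => (key k s0).2
  rw [e1, e2]

lemma preconn_compl_b_aux (k : ℕ) (x : X N) (hx : x ∉ Set.range (fw (pre wb k))) :
    ∃ S : Set (X N), IsPreconnected S ∧ b ∉ S ∧ c ∈ S ∧ a ∈ S ∧ x ∈ S := by
  induction k generalizing x with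
  | zero => exact (hx ⟨x, rfl⟩).elim
  | succ k ih =>
    have h0 : b ∉ Set.range (f 0 : X N → X N) := by
      rintro ⟨y, hy⟩
      rw [← f_one_b] at hy
      exact a_ne_b (f_eq_ne (by simp) hy).2.symm
    obtain ⟨i, y, rfl⟩ := exists_f x
    by_cases hi : i = 1
    · subst hi
      obtain ⟨S, hS, hb, hc, ha, hy⟩ := ih y (by
        rintro ⟨z, rfl⟩
        exact hx ⟨z, rfl⟩)
      refine ⟨f 1 '' S ∪ Set.range (f 0), ?_, ?_, Or.inr (c_mem_range 0), Or.inr ⟨b, f_zero_b⟩,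
        Or.inl ⟨y, hy, rfl⟩⟩
      · exact (hS.image _ (continuous_f 1).continuousOn).union c ⟨a, ha, f_a 1⟩ (c_mem_range 0)
          (preconn_range_f 0)
      · rintro (⟨z, hz, e⟩ | h)
        · rw [← f_one_b] at e
          have := f_inj _ e
          rw [this] at hz
          exact hb hz
        · exact h0 h
    · refine ⟨Set.range (f i) ∪ Set.range (f 0), ?_, ?_, Or.inr (c_mem_range 0),
        Or.inr ⟨b, f_zero_b⟩, Or.inl ⟨y, rfl⟩⟩
      · exact (preconn_range_f i).union c (c_mem_range i) (c_mem_range 0) (preconn_range_f 0)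
      · rintro (⟨z, e⟩ | h)
        · rw [← f_one_b] at e
          exact a_ne_b (f_eq_ne hi e).2.symm
        · exact h0 h

lemma preconn_b (x : X N) (hx : x ≠ b) :
    ∃ S : Set (X N), IsPreconnected S ∧ b ∉ S ∧ c ∈ S ∧ a ∈ S ∧ x ∈ S := by
  by_contra hcon
  apply hx
  apply eq_qm_of_mem
  intro k
  by_contra h
  exact hcon (preconn_compl_b_aux k x h)

lemma preconn_compl_a : IsPreconnected ({a}ᶜ : Set (X N)) := by
  refine isPreconnected_of_forall c ?_
  intro x hx
  obtain ⟨i, y, rfl⟩ := exists_f x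
  by_cases hi : i = 0
  · subst hi
    have hy : y ≠ b := by rintro rfl; exact hx f_zero_b
    obtain ⟨S, hS, hb, hc, ha, hy⟩ := preconn_b y hy
    refine ⟨f 0 '' S, ?_, ⟨a, ha, f_a 0⟩, ⟨y, hy, rfl⟩, hS.image _ (continuous_f 0).continuousOn⟩
    rintro _ ⟨z, hz, rfl⟩ e
    rw [Set.mem_singleton_iff, ← f_zero_b] at e
    exact hb (f_inj _ e ▸ hz)
  · refine ⟨Set.range (f i), ?_, c_mem_range i, ⟨y, rfl⟩, preconn_range_f i⟩
    rintro _ ⟨z, rfl⟩ e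
    rw [Set.mem_singleton_iff, ← f_zero_b] at e
    exact a_ne_b (f_eq_ne hi e).2.symm

/-- Components of the complement of `c`. -/
def D (i : Fin (N + 3)) : Set (X N) := f i '' {a}ᶜ

lemma mem_D {i : Fin (N + 3)} {y : X N} : f i y ∈ D i ↔ y ≠ a := by
  constructor
  · rintro ⟨z, hz, e⟩; rw [← f_inj _ e]; exact hz
  · intro h; exact ⟨y, h, rfl⟩

lemma preconn_D (i : Fin (N + 3)) : IsPreconnected (D i : Set (X N)) :=
  preconn_compl_a.image _ (continuous_f i).continuousOn

lemma c_notMem_D (i : Fin (N + 3)) : (c : X N) ∉ D i := by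
  rintro ⟨y, hy, e⟩; exact hy (f_eq_c.mp e)

lemma exists_D {x : X N} (hx : x ≠ c) : ∃ i, x ∈ D i := by
  obtain ⟨i, y, rfl⟩ := exists_f x
  exact ⟨i, mem_D.mpr fun h => hx (by rw [h, f_a])⟩

lemma D_compl (i : Fin (N + 3)) :
    (D i : Set (X N)) = (⋃ j ∈ ({i}ᶜ : Set (Fin (N+3))), Set.range (f j))ᶜ := by
  ext x
  simp only [Set.mem_compl_iff, Set.mem_iUnion, not_exists, Set.mem_singleton_iff]
  constructor
  · rintro ⟨y, hy, rfl⟩ j hj ⟨z, hz⟩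
    exact hy (f_eq_ne hj hz).2
  · intro h
    obtain ⟨i', y, rfl⟩ := exists_f x
    have : i' = i := by
      by_contra hne
      exact h i' hne ⟨y, rfl⟩
    subst this
    refine mem_D.mpr ?_
    rintro rfl
    obtain ⟨j, hj⟩ := exists_ne i'
    exact h j hj ⟨a, by rw [f_a, f_a]⟩

lemma isOpen_D (i : Fin (N + 3)) : IsOpen (D i : Set (X N)) := by
  rw [D_compl, isOpen_compl_iff]
  exact (Set.toFinite _).isClosed_biUnion fun j _ => isClosed_range_f j

lemma D_disj {i j : Fin (N + 3)} {x : X N} (hi : x ∈ D i) (hj : x ∈ D j) : i = j := by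
  by_contra hne
  obtain ⟨y, hy, rfl⟩ := hi
  obtain ⟨z, hz, e⟩ := hj
  exact hz (f_eq_ne (Ne.symm hne) e).1

lemma same_c {i : Fin (N + 3)} {x y : X N} (hx : x ∈ D i) : Same c x y ↔ y ∈ D i := by
  constructor
  · intro h
    have hC : IsPreconnected (connectedComponentIn {c}ᶜ x) := isPreconnected_connectedComponentIn
    have hsub := hC.subset_of_closure_inter_subset (isOpen_D i) ⟨x, Same.refl h.ne_left, hx⟩ ?_
    · exact hsub h
    · rintro z ⟨hz, hz'⟩
      have hzc : z ≠ c := Same.ne_right hz'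
      have : closure (D i) ⊆ Set.range (f i : X N → X N) :=
        closure_minimal (by rintro _ ⟨y, _, rfl⟩; exact ⟨y, rfl⟩) (isClosed_range_f i)
      obtain ⟨y, rfl⟩ := this hz
      exact mem_D.mpr fun h => hzc (by rw [h, f_a])
  · intro hy
    exact Same.of_preconn (preconn_D i) (c_notMem_D i) hx hy

/-- Same component and cell maps. -/
lemma r_eq {i : Fin (N + 3)} {p : X N} (hp : p ≠ a) {w : X N} (h : r i w = p) : w = f i p := by
  obtain ⟨j, y, rfl⟩ := exists_f w
  by_cases hj : j = i
  · subst hj; rw [r_f] at h; rw [h]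
  · rw [r_f_ne hj] at h; exact (hp h.symm).elim

lemma same_f_iff {i : Fin (N + 3)} {p : X N} (hp : p ≠ a) {x y : X N} :
    Same (f i p) x y ↔ Same p (r i x) (r i y) := by
  constructor
  · intro h; exact h.map (continuous_r i) fun w hw => r_eq hp hw
  · intro h
    have hC : IsPreconnected (connectedComponentIn {p}ᶜ (r i x)) :=
      isPreconnected_connectedComponentIn
    have hxC : r i x ∈ connectedComponentIn {p}ᶜ (r i x) := Same.refl h.ne_left
    have hpC : p ∉ connectedComponentIn {p}ᶜ (r i x) := fun hh => Same.ne_right hh rfl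
    set C := connectedComponentIn {p}ᶜ (r i x) with hCdef
    have hfC : IsPreconnected (f i '' C) := hC.image _ (continuous_f i).continuousOn
    have hpf : f i p ∉ f i '' C := by
      rintro ⟨z, hz, e⟩; rw [f_inj _ e] at hz; exact hpC hz
    by_cases ha : a ∈ C
    · -- everything in other cells attached
      have aux : ∀ x, r i x ∈ C → Same (f i p) c x := by
        intro x hx
        obtain ⟨j, z, rfl⟩ := exists_f x
        by_cases hj : j = i
        · subst hj
          rw [r_f] at hx
          exact Same.of_preconn hfC hpf ⟨a, ha, f_a _⟩ ⟨z, hx, rfl⟩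
        · refine Same.of_preconn (preconn_range_f j) ?_ (c_mem_range j) ⟨z, rfl⟩
          rintro ⟨z', e⟩
          exact hp (f_eq_ne hj e).2
      exact (aux x hxC).symm.trans (aux y h)
    · have aux : ∀ x, r i x ∈ C → x ∈ f i '' C := by
        intro x hx
        obtain ⟨j, z, rfl⟩ := exists_f x
        by_cases hj : j = i
        · subst hj
          rw [r_f] at hx
          exact ⟨z, hx, rfl⟩
        · rw [r_f_ne hj] at hx; exact (ha hx).elim
      exact Same.of_preconn hfC hpf (aux x hxC) (aux y h)

lemma f_ne_a_of_c (i : Fin (N + 3)) {p : X N} (hp : p ≠ b) : f i p ≠ a := by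
  intro h
  rw [← f_zero_b] at h
  by_cases hi : i = 0
  · subst hi; exact hp (f_inj _ h)
  · exact a_ne_b (f_eq_ne hi h).2.symm

lemma f_ne_b (i : Fin (N + 3)) {p : X N} (hp : p ≠ b) : f i p ≠ b := by
  intro h
  rw [← f_one_b] at h
  by_cases hi : i = 1
  · subst hi; exact hp (f_inj _ h)
  · exact a_ne_b (f_eq_ne hi h).2.symm

lemma fw_c_ne (w : List (Fin (N + 3))) : fw w (c : X N) ≠ a ∧ fw w (c : X N) ≠ b := by
  induction w with
  | nil => exact ⟨a_ne_c.symm, b_ne_c.symm⟩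
  | cons i w ih => exact ⟨f_ne_a_of_c i ih.2, f_ne_b i ih.2⟩

lemma sp_f {i : Fin (N + 3)} {p x y : X N} (hp : p ≠ a) (h : Sp p x y) :
    Sp (f i p) (f i x) (f i y) := by
  refine ⟨fun e => h.1 (f_inj _ e), fun e => h.2.1 (f_inj _ e), ?_⟩
  rw [same_f_iff hp, r_f, r_f]; exact h.2.2

/-- Any two points are separated by a branch point. -/
lemma sep_branch {p q : X N} (hpq : p ≠ q) : ∃ w, Sp (fw w c) p q := by
  by_contra hcon
  apply hpq
  refine coind (fun p q => p ≠ q ∧ ¬ ∃ w, Sp (fw w c) p q) ?_ ⟨hpq, hcon⟩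
  rintro p q ⟨hne, hno⟩
  have common : ∃ i p' q', p = f i p' ∧ q = f i q' := by
    by_contra hcom
    push Not at hcom
    have hpc : p ≠ c := by
      rintro rfl
      obtain ⟨j, y, rfl⟩ := exists_f q
      exact hcom j a y (f_a j).symm rfl
    have hqc : q ≠ c := by
      rintro rfl
      obtain ⟨j, y, rfl⟩ := exists_f p
      exact hcom j y a rfl (f_a j).symm
    obtain ⟨i, hi⟩ := exists_D hpc
    refine hno ⟨[], hpc, hqc, ?_⟩
    change ¬ Same c p q
    rw [same_c hi]
    rintro ⟨y, _, rfl⟩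
    obtain ⟨x, _, rfl⟩ := hi
    exact hcom i x y rfl rfl
  obtain ⟨i, p', q', rfl, rfl⟩ := common
  refine ⟨i, p', q', rfl, rfl, fun e => hne (by rw [e]), ?_⟩
  rintro ⟨w, hw⟩
  exact hno ⟨i :: w, sp_f (fw_c_ne w).1 hw⟩

lemma sep_X : SEP (X N) := fun p q h => by
  obtain ⟨w, hw⟩ := sep_branch h
  exact ⟨_, hw⟩

/-- uniform shrinking at a point -/
lemma shrink_star (p : X N) {U : Set (X N)} (hU : U ∈ 𝓝 p) :
    ∃ k, ∀ x : W N, p ∈ Set.range (fw (pre x k)) → Set.range (fw (pre x k)) ⊆ U := by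
  by_contra hcon
  push Not at hcon
  choose x hx hxU using hcon
  have h2 : ∀ k, ∃ y z : W N, qm y = p ∧ qm z ∉ U ∧ ∀ j < k, y j = z j := by
    intro k
    obtain ⟨y, hy⟩ := hx k
    obtain ⟨_, ⟨z, rfl⟩, hzU⟩ := Set.not_subset.mp (hxU k)
    obtain ⟨y, rfl⟩ := qm_surj y
    obtain ⟨z, rfl⟩ := qm_surj z
    obtain ⟨y', hy', hyj⟩ := fw_pre (x k) y k
    obtain ⟨z', hz', hzj⟩ := fw_pre (x k) z k
    refine ⟨y', z', by rw [← hy', hy], by rw [← hz']; exact hzU, fun j hj => ?_⟩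
    rw [hyj j hj, hzj j hj]
  choose y z hy hz hj using h2
  obtain ⟨l, φ, hφ, hl⟩ := CompactSpace.tendsto_subseq y
  have hlz : Filter.Tendsto (z ∘ φ) Filter.atTop (𝓝 l) := by
    rw [tendsto_pi_nhds] at hl ⊢
    intro j
    refine (hl j).congr' ?_
    filter_upwards [Filter.eventually_gt_atTop j] with k hk
    exact hj (φ k) j (lt_of_lt_of_le hk (hφ.id_le k))
  have h1 : qm l = p := by
    have := (continuous_qm.tendsto l).comp hl
    have h3 : (qm ∘ (y ∘ φ)) = fun _ => p := by funext k; exact hy _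
    rw [h3] at this
    exact (tendsto_nhds_unique this tendsto_const_nhds)
  have h2 := (continuous_qm.tendsto l).comp hlz
  rw [h1] at h2
  obtain ⟨k, hk⟩ := (h2.eventually_mem hU).exists
  exact hz _ hk

lemma finite_pre (k : ℕ) : (Set.range fun x : W N => pre x k).Finite := by
  refine (List.finite_length_eq (Fin (N+3)) k).subset ?_
  rintro _ ⟨x, rfl⟩
  exact pre_length x k

instance : LocallyConnectedSpace (X N) := by
  rw [locallyConnectedSpace_iff_connected_subsets]
  intro p U hU
  obtain ⟨k, hk⟩ := shrink_star p hU
  let L : Set (List (Fin (N+3))) := Set.range fun x : W N => pre x k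
  let V : Set (X N) := ⋃₀ {S | ∃ w ∈ L, S = Set.range (fw w) ∧ p ∈ S}
  refine ⟨V, ?_, ?_, ?_⟩
  · have hcl : IsClosed (⋃ w ∈ {w ∈ L | p ∉ Set.range (fw w)}, Set.range (fw w : X N → X N)) :=
      ((finite_pre k).subset (fun w hw => hw.1)).isClosed_biUnion fun w _ =>
        (isCompact_range (continuous_fw w)).isClosed
    refine Filter.mem_of_superset (hcl.isOpen_compl.mem_nhds ?_) ?_
    · simp only [Set.mem_compl_iff, Set.mem_iUnion, not_exists]
      intro w hw; exact hw.2
    · intro y hy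
      obtain ⟨x, rfl⟩ := qm_surj y
      obtain ⟨z, hz⟩ := qm_mem x k
      refine ⟨Set.range (fw (pre x k)), ⟨_, ⟨x, rfl⟩, rfl, ?_⟩, z, hz.symm⟩
      by_contra hp
      refine hy ?_
      simp only [Set.mem_iUnion]
      exact ⟨pre x k, ⟨⟨x, rfl⟩, hp⟩, z, hz.symm⟩
  · refine isPreconnected_sUnion p _ ?_ ?_
    · rintro S ⟨w, _, rfl, hp⟩; exact hp
    · rintro S ⟨w, _, rfl, hp⟩; exact isPreconnected_range (continuous_fw w)
  · rintro y ⟨S, ⟨w, ⟨x, rfl⟩, rfl, hp⟩, hy⟩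
    exact hk x hp hy

end top
end Waz

open Topology
set_option linter.unusedSectionVars false
set_option linter.unusedVariables false

namespace Waz

section reps
variable {Y : Type*} [TopologicalSpace Y]

/-- The complement of `z` has exactly `m` components, with given representatives. -/
def HasReps (z : Y) (m : ℕ) : Prop :=
  ∃ x : Fin m → Y, (∀ i, x i ≠ z) ∧ (∀ i j, Same z (x i) (x j) → i = j) ∧
    ∀ y, y ≠ z → ∃ i, Same z (x i) y

lemma HasReps.ptOrder {z : Y} {m : ℕ} (h : HasReps z m) : ptOrder Y z = m := by
  obtain ⟨x, h1, h2, h3⟩ := h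
  have : setComponents Y {z}ᶜ = Set.range (fun i => connectedComponentIn {z}ᶜ (x i)) := by
    ext C
    constructor
    · rintro ⟨y, hy, rfl⟩
      obtain ⟨i, hi⟩ := h3 y hy
      exact ⟨i, (same_iff_eq hy).1 hi⟩
    · rintro ⟨i, rfl⟩
      exact ⟨x i, h1 i, rfl⟩
  unfold _root_.ptOrder
  rw [this, Set.ncard_range_of_injective]
  · simp
  · intro i j hij
    exact h2 i j ((same_iff_eq (h1 j)).2 hij)

end reps

section waz
variable {N : ℕ}

lemma hasReps_c : HasReps (c : X N) (N + 3) := by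
  have hD : ∀ i, f i (b : X N) ∈ D i := fun i => mem_D.2 (a_ne_b).symm
  refine ⟨fun i => f i b, fun i h => ?_, fun i j h => ?_, fun y hy => ?_⟩
  · rw [f_eq_c] at h; exact a_ne_b h.symm
  · exact D_disj ((same_c (hD i)).1 h) (hD j)
  · obtain ⟨i, hi⟩ := exists_D hy
    exact ⟨i, (same_c (hD i)).2 hi⟩

lemma hasReps_f {p : X N} (hp : p ≠ a) {m : ℕ} (i : Fin (N + 3)) (h : HasReps p m) :
    HasReps (f i p) m := by
  obtain ⟨x, h1, h2, h3⟩ := h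
  refine ⟨fun l => f i (x l), fun l e => h1 l (f_inj i e), fun l l' e => ?_, fun y hy => ?_⟩
  · rw [same_f_iff hp, r_f, r_f] at e
    exact h2 _ _ e
  · obtain ⟨l, hl⟩ := h3 (r i y) (fun e => hy (r_eq hp e))
    refine ⟨l, ?_⟩
    rw [same_f_iff hp, r_f]
    exact hl

lemma hasReps_fw (w : List (Fin (N + 3))) : HasReps (fw w c : X N) (N + 3) := by
  induction w with
  | nil => exact hasReps_c
  | cons i w ih => exact hasReps_f (fw_c_ne w).1 i ih

/-- Iterated retractions. -/
noncomputable def rw' : List (Fin (N + 3)) → X N → X N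
  | [], p => p
  | i :: w, p => rw' w (r i p)

lemma r_ends (i : Fin (N + 3)) {e : X N} (he : e = a ∨ e = b) : r i e = a ∨ r i e = b := by
  rcases he with rfl | rfl
  · rw [← f_zero_b]
    by_cases h : 0 = i
    · subst h; rw [r_f]; right; rfl
    · rw [r_f_ne h, f_zero_b]; left; rfl
  · rw [← f_one_b]
    by_cases h : 1 = i
    · subst h; rw [r_f, f_one_b]; right; rfl
    · rw [r_f_ne h]; left; rfl

lemma rw_ends (w : List (Fin (N + 3))) {e : X N} (he : e = a ∨ e = b) :
    rw' w e = a ∨ rw' w e = b := by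
  induction w generalizing e with
  | nil => exact he
  | cons i w ih => exact ih (r_ends i he)

lemma rw_out (w : List (Fin (N + 3))) {x : X N} (hx : x ∉ Set.range (fw w)) :
    rw' w x = a ∨ rw' w x = b := by
  induction w generalizing x with
  | nil => exact (hx ⟨x, rfl⟩).elim
  | cons i w ih =>
    obtain ⟨j, y, rfl⟩ := exists_f x
    by_cases h : j = i
    · subst h
      simp only [rw', r_f]
      apply ih
      rintro ⟨z, rfl⟩
      exact hx ⟨z, rfl⟩
    · simp only [rw', r_f_ne h]
      exact rw_ends w (Or.inl rfl)

lemma same_fw (w : List (Fin (N + 3))) {q : X N} (hq : ∀ v, fw w q ≠ fw v c) {x y : X N} :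
    Same (fw w q) x y ↔ Same q (rw' w x) (rw' w y) := by
  induction w generalizing x y with
  | nil => rfl
  | cons i w ih =>
    have h : fw w q ≠ a := by
      intro h
      exact hq [] (by simp only [fw, h, f_a])
    simp only [fw, rw']
    rw [same_f_iff h]
    apply ih
    intro v hv
    exact hq (i :: v) (by simp only [fw, hv])

lemma no_three {p : X N} (hp : ∀ v, p ≠ fw v c) {x y z : X N} (h1 : Sp p x y) (h2 : Sp p x z)
    (h3 : Sp p y z) : False := by
  obtain ⟨u, rfl⟩ := qm_surj p
  have hU : ({x}ᶜ ∩ ({y}ᶜ ∩ {z}ᶜ) : Set (X N)) ∈ 𝓝 (qm u) :=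
    Filter.inter_mem (isOpen_compl_singleton.mem_nhds h1.1.symm)
      (Filter.inter_mem (isOpen_compl_singleton.mem_nhds h1.2.1.symm)
        (isOpen_compl_singleton.mem_nhds h2.2.1.symm))
  obtain ⟨k, hk⟩ := shrink u hU
  have hk := hk k le_rfl
  have ex := rw_out _ (fun h => (hk h).1 rfl : x ∉ _)
  have ey := rw_out _ (fun h => (hk h).2.1 rfl : y ∉ _)
  have ez := rw_out _ (fun h => (hk h).2.2 rfl : z ∉ _)
  obtain ⟨q, hq⟩ := qm_mem u k
  rw [hq] at h1 h2 h3 hp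
  have key : ∀ s t, Sp (fw (pre u k) q) s t → rw' (pre u k) s ≠ rw' (pre u k) t := by
    intro s t hst e
    apply hst.2.2
    rw [same_fw _ hp, ← e, ← same_fw _ hp]
    exact Same.refl hst.1
  have k1 := key _ _ h1
  have k2 := key _ _ h2
  have k3 := key _ _ h3
  rcases ex with ex | ex <;> rcases ey with ey | ey <;> rcases ez with ez | ez <;>
    simp_all

lemma hasReps_or (p : X N) : HasReps p 1 ∨ HasReps p 2 ∨ ∃ w, p = fw w c := by
  by_cases hp : ∃ w, p = fw w c
  · exact Or.inr (Or.inr hp)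
  push Not at hp
  have : ∃ x, x ≠ p := by
    by_cases h : a = p
    · exact ⟨b, fun h' => a_ne_b (h.trans h'.symm)⟩
    · exact ⟨a, h⟩
  obtain ⟨x, hx⟩ := this
  by_cases h : ∃ y, Sp p x y
  · right; left
    obtain ⟨y, hy⟩ := h
    refine ⟨![x, y], ?_, ?_, ?_⟩
    · intro i; fin_cases i
      · exact hx
      · exact hy.2.1
    · intro i j; fin_cases i <;> fin_cases j <;> intro h
      · rfl
      · exact (hy.2.2 h).elim
      · exact (hy.2.2 h.symm).elim
      · rfl
    · intro z hz
      by_contra hcon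
      push Not at hcon
      exact no_three hp hy ⟨hx, hz, hcon 0⟩ ⟨hy.2.1, hz, hcon 1⟩
  · left
    push Not at h
    refine ⟨fun _ => x, fun _ => hx, fun i j _ => Subsingleton.elim _ _, fun y hy => ⟨0, ?_⟩⟩
    by_contra hcon
    exact h y ⟨hx, hy, hcon⟩

lemma exists_reps (p : X N) : ∃ m, m ≤ N + 3 ∧ HasReps p m := by
  rcases hasReps_or p with h | h | ⟨w, rfl⟩
  · exact ⟨1, by omega, h⟩
  · exact ⟨2, by omega, h⟩
  · exact ⟨_, le_rfl, hasReps_fw w⟩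

lemma branch_of_order {p : X N} (h : ptOrder (X N) p = N + 3) : ∃ w, p = fw w c := by
  rcases hasReps_or p with h' | h' | h'
  · rw [h'.ptOrder] at h; omega
  · rw [h'.ptOrder] at h; omega
  · exact h'

lemma conn_branch {S : Set (X N)} (hS : IsPreconnected S) {p q z : X N} (hp : p ∈ S) (hq : q ∈ S)
    (h : Sp z p q) : z ∈ S := by
  by_contra hz
  exact h.2.2 (Same.of_preconn hS hz hp hq)

lemma circle_minus (z : Circle) : IsPreconnected ({z}ᶜ : Set Circle) :=
  (Circle.isPathConnected_compl_singleton z).isConnected.isPreconnected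

lemma no_circle (S : Set (X N)) : IsEmpty (S ≃ₜ Circle) := by
  refine ⟨fun e => ?_⟩
  have hne : e.symm 1 ≠ e.symm (-1) := by
    intro h
    have := e.symm.injective h
    have h2 := congrArg (fun z : Circle => (z : ℂ)) this
    norm_num at h2
  have hpq : (e.symm 1 : X N) ≠ e.symm (-1) := fun h => hne (Subtype.ext h)
  obtain ⟨z, hz⟩ := sep_X _ _ hpq
  have hS : IsPreconnected S := by
    rw [isPreconnected_iff_preconnectedSpace]
    exact e.symm.surjective.denseRange.preconnectedSpace e.symm.continuous
  have hzS := conn_branch hS (e.symm 1).2 (e.symm (-1)).2 hz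
  let T : Set (X N) := (fun u : Circle => (e.symm u : X N)) '' {e ⟨z, hzS⟩}ᶜ
  have hT : IsPreconnected T :=
    (circle_minus _).image _ (continuous_subtype_val.comp e.symm.continuous).continuousOn
  have hzT : z ∉ T := by
    rintro ⟨u, hu, hu'⟩
    apply hu
    rw [Set.mem_singleton_iff, ← e.apply_symm_apply u]
    congr 1
    exact Subtype.ext hu'
  apply hz.2.2
  refine Same.of_preconn hT hzT ⟨1, ?_, rfl⟩ ⟨-1, ?_, rfl⟩
  · intro h
    rw [Set.mem_singleton_iff] at h
    apply hz.1; rw [h]; simp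
  · intro h
    rw [Set.mem_singleton_iff] at h
    apply hz.2.1; rw [h]; simp

theorem isWazewski : IsWazewskiDendrite (N + 3) (X N) := by
  refine ⟨⟨inferInstance, inferInstance, inferInstance, inferInstance, inferInstance, no_circle⟩,
    fun p => ?_, ?_⟩
  · rcases hasReps_or p with h | h | ⟨w, rfl⟩
    · exact Or.inl h.ptOrder
    · exact Or.inr (Or.inl h.ptOrder)
    · exact Or.inr (Or.inr (hasReps_fw w).ptOrder)
  · rintro A ⟨e⟩
    have hne : e.symm 0 ≠ e.symm 1 := fun h => zero_ne_one (e.symm.injective h)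
    obtain ⟨w, hw⟩ := sep_branch (fun h => hne (Subtype.ext h) : (e.symm 0 : X N) ≠ e.symm 1)
    have hA : IsPreconnected A := by
      rw [isPreconnected_iff_preconnectedSpace]
      exact e.symm.surjective.denseRange.preconnectedSpace e.symm.continuous
    exact ⟨_, conn_branch hA (e.symm 0).2 (e.symm 1).2 hw, (hasReps_fw w).ptOrder⟩

end waz
end Waz

open Topology
set_option linter.unusedSectionVars false
set_option linter.unusedVariables false

namespace Waz

section grp
variable {Y : Type*} [TopologicalSpace Y]

lemma mulA (g h : Y ≃ₜ Y) (x : Y) : (g * h) x = g (h x) := rfl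
lemma oneA (x : Y) : (1 : Y ≃ₜ Y) x = x := rfl
lemma invA (g : Y ≃ₜ Y) (x : Y) : g⁻¹ (g x) = x := g.symm_apply_apply x
lemma invA' (g : Y ≃ₜ Y) (x : Y) : g (g⁻¹ x) = x := g.apply_symm_apply x

lemma powA (g : Y ≃ₜ Y) (k : ℕ) (x : Y) : (g ^ k) x = g^[k] x := by
  induction k generalizing x with
  | zero => rfl
  | succ k ih => rw [pow_succ, mulA, ih]; rfl

lemma pow_fix {g : Y ≃ₜ Y} {p : Y} (hp : g p = p) (k : ℕ) : (g ^ k) p = p := by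
  induction k with
  | zero => rfl
  | succ k ih => rw [pow_succ, mulA, hp, ih]

lemma same_fix {g : Y ≃ₜ Y} {p x y : Y} (hp : g p = p) :
    Same p (g x) (g y) ↔ Same p x y := by
  conv_lhs => rw [← hp]
  exact same_homeo_iff g

lemma same_pow {g : Y ≃ₜ Y} {p x : Y} (hp : g p = p) (hx : x ≠ p) (d : ℕ)
    (h : Same p x ((g ^ d) x)) (e : ℕ) : Same p x ((g ^ (d * e)) x) := by
  induction e with
  | zero => exact Same.refl hx
  | succ e ih =>
    rw [mul_add, mul_one, add_comm, pow_add, mulA]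
    exact h.trans ((same_fix (pow_fix hp d)).2 ih)

lemma same_pow_inj {g : Y ≃ₜ Y} {p x : Y} {q : ℕ} (hq : q.Prime) (hg : g ^ q = 1) (hp : g p = p)
    (hx : x ≠ p) (hs : ¬ Same p x (g x)) {d : ℕ} (h0 : 0 < d) (hd : d < q) :
    ¬ Same p x ((g ^ d) x) := by
  intro h
  apply hs
  have hc : Nat.Coprime d q := ((Nat.Prime.coprime_iff_not_dvd hq).2 (Nat.not_dvd_of_pos_of_lt h0 hd)).symm
  obtain ⟨e, -, he⟩ := Nat.exists_mul_mod_eq_one_of_coprime hc hq.one_lt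
  have h2 := same_pow hp hx d h e
  rw [← Nat.div_add_mod (d * e) q, he, pow_add, pow_mul, hg, one_pow, one_mul, pow_one] at h2
  exact h2

lemma orbit_card {g : Y ≃ₜ Y} {p x : Y} {q m : ℕ} (hq : q.Prime) (hg : g ^ q = 1) (hp : g p = p)
    (hx : x ≠ p) (hs : ¬ Same p x (g x)) (hm : HasReps p m) :
    q ≤ m ∧ (q = m → ∀ y, y ≠ p → ∃ i : ℕ, i < q ∧ Same p ((g ^ i) x) y) := by
  obtain ⟨z, h1, h2, h3⟩ := hm
  have hne : ∀ i : ℕ, (g ^ i) x ≠ p := by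
    intro i h
    rw [← pow_fix hp i] at h
    exact hx ((g ^ i).injective h)
  choose l hl using fun i : Fin q => h3 _ (hne i)
  have key : ∀ i j : Fin q, i < j → l i ≠ l j := by
    intro i j hij e
    have h4 := (hl i).symm.trans (e ▸ hl j)
    have : (j : ℕ) = i + (j - i : ℕ) := by have : (i : ℕ) < j := hij; omega
    rw [this, pow_add, mulA, same_fix (pow_fix hp i)] at h4
    exact same_pow_inj hq hg hp hx hs (by have : (i : ℕ) < j := hij; omega) (by omega) h4
  have hinj : Function.Injective l := by
    intro i j e
    rcases lt_trichotomy i j with h | h | h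
    · exact (key i j h e).elim
    · exact h
    · exact (key j i h e.symm).elim
  constructor
  · simpa using Fintype.card_le_of_injective l hinj
  · rintro rfl y hy
    have hsurj := Finite.surjective_of_injective hinj
    obtain ⟨k, hk⟩ := h3 y hy
    obtain ⟨i, rfl⟩ := hsurj k
    exact ⟨i, i.2, (hl i).symm.trans hk⟩

lemma unique_fix {g : Y ≃ₜ Y} {p x : Y} {q : ℕ} (hq : q.Prime) (hg : g ^ q = 1) (hp : g p = p)
    (hx : x ≠ p) (hs : ¬ Same p x (g x)) (hm : HasReps p q) {y : Y} (hy : g y = y) : y = p := by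
  by_contra hne
  obtain ⟨i, hi, h⟩ := (orbit_card hq hg hp hx hs hm).2 rfl y hne
  have h2 := (same_fix hp).2 h
  rw [hy] at h2
  have h3 := h.trans h2.symm
  rw [← mulA, ← pow_succ', pow_succ, mulA, same_fix (pow_fix hp i)] at h3
  exact hs h3

end grp

section fin
variable {N : ℕ}

lemma exists_moved {g : X N ≃ₜ X N} {q : ℕ} (hq : 0 < q) (hg : g ^ q = 1) (h1 : g ≠ 1) :
    ∃ p x, g p = p ∧ x ≠ p ∧ ¬ Same p x (g x) := by
  by_contra hcon
  push Not at hcon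
  apply h1
  ext1 x
  refine eq_id_of_finite_order sep_X hq (fun x => ?_) (fun p hp x hx => hcon p x hp hx) x
  rw [← powA, hg]; rfl

lemma reps_of_moved {g : X N ≃ₜ X N} {q : ℕ} (hq : q.Prime) (hg : g ^ q = 1) {p x : X N}
    (hp : g p = p) (hx : x ≠ p) (hs : ¬ Same p x (g x)) :
    q ≤ N + 3 ∧ (q = N + 3 → HasReps p q) := by
  obtain ⟨m, hm, hr⟩ := exists_reps p
  have := (orbit_card hq hg hp hx hs hr).1
  refine ⟨this.trans hm, fun e => ?_⟩
  have : q = m := by omega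
  rw [this]; exact hr

theorem finite_part1 (H : Subgroup (X N ≃ₜ X N)) [Finite H] (q : ℕ) (hq : q.Prime)
    (hd : q ∣ Nat.card H) : q ≤ N + 3 := by
  have : Fact q.Prime := ⟨hq⟩
  obtain ⟨x, hx⟩ := exists_prime_orderOf_dvd_card' q hd
  have hg : (x : X N ≃ₜ X N) ^ q = 1 := by
    rw [← hx]
    have := pow_orderOf_eq_one x
    exact_mod_cast congrArg Subtype.val this
  have h1 : (x : X N ≃ₜ X N) ≠ 1 := by
    intro h
    have : x = 1 := Subtype.ext h
    rw [this, orderOf_one] at hx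
    exact hq.one_lt.ne hx
  obtain ⟨p, y, hp, hy, hs⟩ := exists_moved hq.pos hg h1
  exact (reps_of_moved hq hg hp hy hs).1

theorem finite_part2 (H : Subgroup (X N ≃ₜ X N)) [Finite H] (hn : (N + 3).Prime) :
    ¬ (N + 3) ^ 2 ∣ Nat.card H := by
  intro hd
  have : Fact (N + 3).Prime := ⟨hn⟩
  set n := N + 3 with hnn
  obtain ⟨P, hP⟩ := Sylow.exists_subgroup_card_pow_prime (G := H) n hd
  have hcomm : ∀ x y : P, x * y = y * x := fun x y => (IsPGroup.isMulCommutative_of_card_eq_prime_sq hP).is_comm.comm x y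
  have hdP : n ∣ Nat.card P := by rw [hP]; exact dvd_pow_self n (by norm_num)
  obtain ⟨h, hh⟩ := exists_prime_orderOf_dvd_card' n hdP
  let φ : P →* (X N ≃ₜ X N) := H.subtype.comp P.subtype
  have hφ : Function.Injective φ := H.subtype_injective.comp P.subtype_injective
  have hg : φ h ^ n = 1 := by rw [← map_pow, ← hh, pow_orderOf_eq_one, map_one]
  have h1 : φ h ≠ 1 := by
    intro e
    rw [← map_one φ] at e
    rw [hφ e, orderOf_one] at hh
    exact hn.one_lt.ne hh
  obtain ⟨p, x, hp, hx, hs⟩ := exists_moved hn.pos hg h1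
  have hr := (reps_of_moved hn hg hp hx hs).2 rfl
  have hfix : ∀ g : P, φ g p = p := by
    intro g
    apply unique_fix hn hg hp hx hs hr
    rw [← mulA, ← map_mul, hcomm, map_mul, mulA, hp]
  have hne : ∀ g : P, φ g x ≠ p := by
    intro g e
    rw [← hfix g] at e
    exact hx ((φ g).injective e)
  have horb := (orbit_card hn hg hp hx hs hr).2 rfl
  choose i hi hi2 using fun g : P => horb _ (hne g)
  have : ¬ Function.Injective (fun g => (⟨i g, hi g⟩ : Fin n)) := by
    intro hinj
    have := Nat.card_le_card_of_injective _ hinj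
    rw [hP, Nat.card_fin] at this
    have := hn.two_le
    nlinarith
  rw [Function.Injective] at this
  push Not at this
  obtain ⟨g, g', he, hgg⟩ := this
  have he' : i g = i g' := by simpa using he
  have hk0 : Same p x (φ (g⁻¹ * g') x) := by
    have := (hi2 g).symm.trans (he' ▸ hi2 g')
    rw [← same_fix (hfix g⁻¹), ← mulA, ← map_mul, ← mulA, ← map_mul, inv_mul_cancel] at this
    simpa [oneA] using this
  have hk1 : g⁻¹ * g' ≠ 1 := fun e => hgg (inv_mul_eq_one.1 e)
  generalize g⁻¹ * g' = k at hk0 hk1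
  have hpres : ∀ e : ℕ, ∀ y, y ≠ p → Same p y (φ (k ^ e) y) := by
    intro e
    induction e with
    | zero => intro y hy; rw [pow_zero, map_one]; exact Same.refl hy
    | succ e ih =>
      intro y hy
      have hy1 : Same p y (φ k y) := by
        obtain ⟨j, hj, h5⟩ := horb y hy
        have h6 := (same_fix (pow_fix hp j)).2 hk0
        rw [← mulA, ← map_pow, ← map_mul, hcomm, map_mul, mulA, map_pow] at h6
        have h7 := (same_fix (hfix k)).2 h5
        exact h5.symm.trans (h6.trans h7)
      rw [pow_succ, map_mul, mulA]
      exact hy1.trans (ih _ hy1.ne_right)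
  have hkn : k ^ (n * n) = 1 := by
    rw [← sq, ← hP]; exact pow_card_eq_one'
  obtain ⟨e, he1, he2⟩ : ∃ e : ℕ, k ^ e ≠ 1 ∧ (k ^ e) ^ n = 1 := by
    by_cases h : k ^ n = 1
    · exact ⟨1, by simpa using hk1, by simpa using h⟩
    · exact ⟨n, h, by rw [← pow_mul]; exact hkn⟩
  have hg' : φ (k ^ e) ^ n = 1 := by rw [← map_pow, he2, map_one]
  have h1' : φ (k ^ e) ≠ 1 := by
    intro e'
    rw [← map_one φ] at e'
    exact he1 (hφ e')
  obtain ⟨p', x', hp', hx', hs'⟩ := exists_moved hn.pos hg' h1'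
  have hr' := (reps_of_moved hn hg' hp' hx' hs').2 rfl
  have := unique_fix hn hg' hp' hx' hs' hr' (hfix (k ^ e))
  subst this
  exact hs' (hpres e x' hx')

end fin
end Waz

open Topology
set_option linter.unusedSectionVars false
set_option linter.unusedVariables false

namespace Waz

noncomputable section homeos
variable {N : ℕ}

lemma l10 : (1 : Fin (N + 3)) ≠ 0 := by simp
lemma l20 : (2 : Fin (N + 3)) ≠ 0 := by
  rw [Ne, Fin.ext_iff]; simp [Nat.mod_eq_of_lt]
lemma l21 : (2 : Fin (N + 3)) ≠ 1 := by
  rw [Ne, Fin.ext_iff]; simp [Nat.mod_eq_of_lt]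

/-- Gluing maps defined on the cells. -/
def glue {Z : Type*} (g : Fin (N + 3) → X N → Z) (x : X N) : Z :=
  g (exists_f x).choose (exists_f x).choose_spec.choose

lemma glue_f {Z : Type*} {g : Fin (N + 3) → X N → Z} (hg : ∀ i j, g i a = g j a)
    (i : Fin (N + 3)) (u : X N) : glue g (f i u) = g i u := by
  unfold glue
  have h := (exists_f (f i u)).choose_spec.choose_spec
  generalize (exists_f (f i u)).choose_spec.choose = v at h
  generalize (exists_f (f i u)).choose = j at h
  by_cases hij : i = j
  · subst hij; rw [f_inj i h]
  · obtain ⟨rfl, rfl⟩ := f_eq_ne hij h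
    exact hg _ _

lemma continuous_of_cells {Z : Type*} [TopologicalSpace Z] {g : X N → Z}
    (hg : ∀ i, Continuous (fun u => g (f i u))) : Continuous g := by
  rw [continuous_iff_isClosed]
  intro s hs
  have : g ⁻¹' s = ⋃ i, f i '' ((fun u => g (f i u)) ⁻¹' s) := by
    ext x
    simp only [Set.mem_preimage, Set.mem_iUnion, Set.mem_image]
    constructor
    · intro h
      obtain ⟨i, u, rfl⟩ := exists_f x
      exact ⟨i, u, h, rfl⟩
    · rintro ⟨i, u, h, rfl⟩; exact h
  rw [this]
  exact isClosed_iUnion_of_finite fun i => isClosedMap_f i _ (hs.preimage (hg i))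

lemma continuous_glue {Z : Type*} [TopologicalSpace Z] {g : Fin (N + 3) → X N → Z}
    (hg : ∀ i j, g i a = g j a) (hc : ∀ i, Continuous (g i)) : Continuous (glue g) := by
  apply continuous_of_cells
  intro i
  simp only [glue_f hg]
  exact hc i

/-- Homeomorphisms fixing the point `a`. -/
def Ga (N : ℕ) : Subgroup (X N ≃ₜ X N) where
  carrier := {g | g a = a}
  mul_mem' := by
    intro g h hg hh
    change g (h a) = a
    rw [show h a = a from hh, show g a = a from hg]
  one_mem' := rfl
  inv_mem' := by
    intro g hg
    change g⁻¹ a = a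
    conv_lhs => rw [← show g a = a from hg]
    exact invA g a

lemma Ga_a (g : Ga N) : g.1 a = a := g.2

lemma ext_cells {g h : X N ≃ₜ X N} (H : ∀ i u, g (f i u) = h (f i u)) : g = h := by
  ext1 x
  obtain ⟨i, u, rfl⟩ := exists_f x
  exact H i u

lemma blk_aux (π : Equiv.Perm (Fin (N + 3))) (h : Fin (N + 3) → Ga N) (i j : Fin (N + 3)) :
    f (π i) ((h i).1 a) = f (π j) ((h j).1 a) := by
  rw [Ga_a, Ga_a, f_a, f_a]

/-- Block homeomorphisms. -/
def blk (π : Equiv.Perm (Fin (N + 3))) (h : Fin (N + 3) → Ga N) : X N ≃ₜ X N where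
  toFun := glue (fun i u => f (π i) ((h i).1 u))
  invFun := glue (fun i u => f (π⁻¹ i) ((h (π⁻¹ i))⁻¹.1 u))
  left_inv x := by
    obtain ⟨i, u, rfl⟩ := exists_f x
    rw [glue_f (blk_aux π h), glue_f (blk_aux π⁻¹ (fun i => (h (π⁻¹ i))⁻¹))]
    simp only [show π⁻¹ (π i) = i from π.symm_apply_apply i]
    congr 1
    exact invA (h i).1 u
  right_inv x := by
    obtain ⟨i, u, rfl⟩ := exists_f x
    rw [glue_f (blk_aux π⁻¹ (fun i => (h (π⁻¹ i))⁻¹)), glue_f (blk_aux π h)]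
    simp only [show π (π⁻¹ i) = i from π.apply_symm_apply i]
    congr 1
    exact invA' (h (π⁻¹ i)).1 u
  continuous_toFun := continuous_glue (blk_aux π h)
    (fun i => (continuous_f _).comp (h i).1.continuous)
  continuous_invFun := continuous_glue (blk_aux π⁻¹ (fun i => (h (π⁻¹ i))⁻¹))
    (fun i => (continuous_f _).comp (h (π⁻¹ i))⁻¹.1.continuous)

lemma blk_f (π : Equiv.Perm (Fin (N + 3))) (h : Fin (N + 3) → Ga N) (i : Fin (N + 3)) (u : X N) :
    blk π h (f i u) = f (π i) ((h i).1 u) :=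
  glue_f (g := fun i u => f (π i) ((h i).1 u)) (blk_aux π h) i u

lemma blk_mul (π π' : Equiv.Perm (Fin (N + 3))) (h h' : Fin (N + 3) → Ga N) :
    blk π h * blk π' h' = blk (π * π') (fun i => h (π' i) * h' i) := by
  apply ext_cells
  intro i u
  rw [mulA, blk_f, blk_f, blk_f]
  rfl

lemma blk_one : blk (1 : Equiv.Perm (Fin (N + 3))) 1 = 1 := by
  apply ext_cells
  intro i u
  rw [blk_f]; rfl

/-- Symbol permutation homeomorphisms. -/
def sig : Equiv.Perm (Fin (N + 3)) →* (X N ≃ₜ X N) where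
  toFun π := blk π 1
  map_one' := blk_one
  map_mul' π π' := by rw [blk_mul]; congr 1

lemma sig_f (π : Equiv.Perm (Fin (N + 3))) (i : Fin (N + 3)) (u : X N) :
    sig π (f i u) = f (π i) u := blk_f π 1 i u

/-- Block homeomorphisms with trivial permutation. -/
def blk1 : (Fin (N + 3) → Ga N) →* (X N ≃ₜ X N) where
  toFun h := blk 1 h
  map_one' := blk_one
  map_mul' π π' := by rw [blk_mul]; rfl

lemma blk1_f (h : Fin (N + 3) → Ga N) (i : Fin (N + 3)) (u : X N) :
    blk1 h (f i u) = f i ((h i).1 u) := blk_f 1 h i u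

/-- Action on a single cell. -/
def iota (i : Fin (N + 3)) : Ga N →* (X N ≃ₜ X N) :=
  blk1.comp (MonoidHom.mulSingle (fun _ => Ga N) i)

lemma iota_f (i : Fin (N + 3)) (g : Ga N) (u : X N) : iota i g (f i u) = f i (g.1 u) := by
  unfold iota; simp [blk1_f]

lemma iota_f_ne {i j : Fin (N + 3)} (h : j ≠ i) (g : Ga N) (u : X N) :
    iota i g (f j u) = f j u := by
  unfold iota; simp [blk1_f, h]

lemma iota_mem {i : Fin (N + 3)} (hi : i ≠ 0) (g : Ga N) : iota i g ∈ Ga N := by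
  change iota i g a = a
  rw [← f_zero_b, iota_f_ne hi.symm]

/-- Same as `iota 2` with values in `Ga`. -/
def io2 (g : Ga N) : Ga N := ⟨iota 2 g, iota_mem l20 g⟩

/-- The flip. -/
def rho : X N ≃ₜ X N := sig (Equiv.swap 0 1)

lemma rho_rho (x : X N) : rho (rho x) = x := by
  rw [← mulA]; unfold rho; rw [← map_mul, Equiv.swap_mul_self, map_one]; rfl

lemma rho_b : rho (b : X N) = a := by
  unfold rho
  rw [← f_one_b, sig_f, Equiv.swap_apply_right, f_zero_b]

lemma rho_a : rho (a : X N) = b := by rw [← rho_b, rho_rho]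

def sIn (i : Fin (N + 3)) (u : X N) : X N :=
  if i = 1 then f 0 u else if i = 0 then f 1 (f 0 (rho u)) else f i u

lemma sIn_a (i : Fin (N + 3)) : sIn i a = (c : X N) := by
  unfold sIn
  split_ifs
  · exact f_a _
  · rw [rho_a, f_zero_b, f_a]
  · exact f_a _

lemma sIn_c (i : Fin (N + 3)) : Continuous (sIn i : X N → X N) := by
  unfold sIn
  split_ifs
  · exact continuous_f _
  · exact (continuous_f _).comp ((continuous_f _).comp rho.continuous)
  · exact continuous_f _

lemma sIn_h (i j : Fin (N + 3)) : sIn i (a : X N) = sIn j a := by rw [sIn_a, sIn_a]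

def sOut (i : Fin (N + 3)) (u : X N) : X N :=
  if i = 0 then glue sIn u else f 1 (f i u)

lemma sOut_a (i : Fin (N + 3)) : sOut i a = f 1 (c : X N) := by
  unfold sOut
  split_ifs
  · rw [← f_zero_b, glue_f sIn_h]
    unfold sIn
    rw [if_neg l10.symm, if_pos rfl, rho_b, f_a]
  · rw [f_a]

lemma sOut_c (i : Fin (N + 3)) : Continuous (sOut i : X N → X N) := by
  unfold sOut
  split_ifs
  · exact continuous_glue sIn_h sIn_c
  · exact (continuous_f _).comp (continuous_f _)

lemma sOut_h (i j : Fin (N + 3)) : sOut i (a : X N) = sOut j a := by rw [sOut_a, sOut_a]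

def tIn (i : Fin (N + 3)) (u : X N) : X N :=
  if i = 0 then f 0 (f 0 (rho u)) else f i u

lemma tIn_a (i : Fin (N + 3)) : tIn i a = (c : X N) := by
  unfold tIn
  split_ifs
  · rw [rho_a, f_zero_b, f_a]
  · exact f_a _

lemma tIn_c (i : Fin (N + 3)) : Continuous (tIn i : X N → X N) := by
  unfold tIn
  split_ifs
  · exact (continuous_f _).comp ((continuous_f _).comp rho.continuous)
  · exact continuous_f _

lemma tIn_h (i j : Fin (N + 3)) : tIn i (a : X N) = tIn j a := by rw [tIn_a, tIn_a]

def tOut (i : Fin (N + 3)) (u : X N) : X N :=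
  if i = 1 then glue tIn u else if i = 0 then f 0 (f 1 u) else f 0 (f i u)

lemma tOut_a (i : Fin (N + 3)) : tOut i a = f 0 (c : X N) := by
  unfold tOut
  split_ifs
  · rw [← f_zero_b, glue_f tIn_h]
    unfold tIn
    rw [if_pos rfl, rho_b, f_a]
  · rw [f_a]
  · rw [f_a]

lemma tOut_c (i : Fin (N + 3)) : Continuous (tOut i : X N → X N) := by
  unfold tOut
  split_ifs
  · exact continuous_glue tIn_h tIn_c
  · exact (continuous_f _).comp (continuous_f _)
  · exact (continuous_f _).comp (continuous_f _)

lemma tOut_h (i j : Fin (N + 3)) : tOut i (a : X N) = tOut j a := by rw [tOut_a, tOut_a]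

/-- The shifting homeomorphism. -/
def sh : X N ≃ₜ X N where
  toFun := glue sOut
  invFun := glue tOut
  left_inv x := by
    obtain ⟨i, u, rfl⟩ := exists_f x
    rw [glue_f sOut_h]
    by_cases h0 : i = 0
    · subst h0
      obtain ⟨j, v, rfl⟩ := exists_f u
      simp only [sOut, if_true, glue_f sIn_h]
      unfold sIn
      split_ifs with h1 h2
      · subst h1; rw [glue_f tOut_h]; simp [tOut]
      · subst h2; rw [glue_f tOut_h]; simp [tOut, glue_f tIn_h, tIn, rho_rho]
      · rw [glue_f tOut_h]; simp [tOut, h1, h2]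
    · simp only [sOut, if_neg h0]
      rw [glue_f tOut_h]; simp [tOut, glue_f tIn_h, tIn, h0]
  right_inv x := by
    obtain ⟨i, u, rfl⟩ := exists_f x
    rw [glue_f tOut_h]
    by_cases h1 : i = 1
    · subst h1
      obtain ⟨j, v, rfl⟩ := exists_f u
      simp only [tOut, if_true, glue_f tIn_h]
      unfold tIn
      split_ifs with h0
      · subst h0; rw [glue_f sOut_h]; simp [sOut, glue_f sIn_h, sIn, rho_rho]
      · rw [glue_f sOut_h]; simp [sOut, h0]
    · simp only [tOut, if_neg h1]
      split_ifs with h0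
      · rw [glue_f sOut_h]; simp [sOut, glue_f sIn_h, sIn, h0]
      · rw [glue_f sOut_h]; simp [sOut, glue_f sIn_h, sIn, h0, h1]
  continuous_toFun := continuous_glue sOut_h sOut_c
  continuous_invFun := continuous_glue tOut_h tOut_c

lemma sh_f {i : Fin (N + 3)} (h : i ≠ 0) (u : X N) : sh (f i u) = f 1 (f i u) := by
  change glue sOut _ = _
  rw [glue_f sOut_h, sOut, if_neg h]

lemma sh_01 (u : X N) : sh (f 0 (f 1 u)) = f 0 u := by
  change glue sOut _ = _
  rw [glue_f sOut_h, sOut, if_pos rfl, glue_f sIn_h, sIn, if_pos rfl]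

lemma sh_00 (u : X N) : sh (f 0 (f 0 u)) = f 1 (f 0 (rho u)) := by
  change glue sOut _ = _
  rw [glue_f sOut_h, sOut, if_pos rfl, glue_f sIn_h, sIn, if_neg l10.symm, if_pos rfl]

lemma sh_0j {j : Fin (N + 3)} (h0 : j ≠ 0) (h1 : j ≠ 1) (u : X N) : sh (f 0 (f j u)) = f j u := by
  change glue sOut _ = _
  rw [glue_f sOut_h, sOut, if_pos rfl, glue_f sIn_h, sIn, if_neg h1, if_neg h0]

lemma sh_c : sh (c : X N) = f 1 c := by
  conv_lhs => rw [← f_a 1]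
  rw [sh_f l10, f_a]

lemma sh_a : sh (a : X N) = a := by
  conv_lhs => rw [← f_zero_b, ← f_one_b, sh_01]
  exact f_zero_b

def shG : Ga N := ⟨sh, sh_a⟩

/-- Truncated diagonal homeomorphisms. -/
def Tr : ℕ → (ℕ → Ga N) → Ga N
  | 0, _ => 1
  | k + 1, h => ⟨blk1 (fun i => if i = 1 then Tr k (fun l => h (l + 1)) else if i = 2 then h 0
      else 1), by
        change blk1 _ a = a
        conv_lhs => rw [← f_zero_b]
        rw [blk1_f, if_neg l10.symm, if_neg l20.symm]
        exact f_zero_b⟩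

lemma Tr_1 (k : ℕ) (h : ℕ → Ga N) (u : X N) :
    (Tr (k + 1) h).1 (f 1 u) = f 1 ((Tr k (fun l => h (l + 1))).1 u) := by
  simp only [Tr]; rw [blk1_f, if_pos rfl]

lemma Tr_2 (k : ℕ) (h : ℕ → Ga N) (u : X N) :
    (Tr (k + 1) h).1 (f 2 u) = f 2 ((h 0).1 u) := by
  simp only [Tr]; rw [blk1_f, if_neg l21, if_pos rfl]

lemma Tr_j (k : ℕ) (h : ℕ → Ga N) {j : Fin (N + 3)} (h1 : j ≠ 1) (h2 : j ≠ 2) (u : X N) :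
    (Tr (k + 1) h).1 (f j u) = f j u := by
  simp only [Tr]; rw [blk1_f, if_neg h1, if_neg h2]; rfl

lemma Tr_mul (k : ℕ) (h h' : ℕ → Ga N) : Tr k (h * h') = Tr k h * Tr k h' := by
  induction k generalizing h h' with
  | zero => simp [Tr]
  | succ k ih =>
    apply Subtype.ext
    change blk1 _ = blk1 _ * blk1 _
    rw [← map_mul]
    congr 1
    funext i
    simp only [Pi.mul_apply]
    have := ih (fun l => h (l + 1)) (fun l => h' (l + 1))
    split_ifs
    · exact this
    · rfl
    · simp

/-- Cells around `b`. -/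
def cell (N k : ℕ) : Set (X N) := Set.range (fw (pre (wb : W N) k))

lemma mem_cell_succ (k : ℕ) (u : X N) : f 1 u ∈ cell N (k + 1) ↔ u ∈ cell N k := by
  constructor
  · rintro ⟨v, hv⟩
    have : f 1 (fw (pre (wb : W N) k) v) = f 1 u := hv
    exact ⟨v, f_inj _ this⟩
  · rintro ⟨v, rfl⟩
    exact ⟨v, rfl⟩

lemma cell_zero (u : X N) : u ∈ cell N 0 := ⟨u, rfl⟩

lemma b_mem_cell (k : ℕ) : (b : X N) ∈ cell N k := by
  induction k with
  | zero => exact cell_zero _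
  | succ k ih => rw [← f_one_b, mem_cell_succ]; exact ih

lemma exists_notMem_cell {x : X N} (hx : x ≠ b) : ∃ k, x ∉ cell N k := by
  by_contra h
  push Not at h
  exact hx (eq_qm_of_mem wb x h)

lemma notMem_cell_succ {x : X N} {k : ℕ} (hx : x ∉ cell N (k + 1)) :
    (∃ u, u ∉ cell N k ∧ x = f 1 u) ∨ (∃ j u, j ≠ 1 ∧ x = f j u) := by
  obtain ⟨i, u, rfl⟩ := exists_f x
  by_cases h : i = 1
  · subst h
    rw [mem_cell_succ] at hx
    exact Or.inl ⟨u, hx, rfl⟩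
  · exact Or.inr ⟨i, u, h, rfl⟩

lemma cell_succ_not {x : X N} {k : ℕ} {j : Fin (N + 3)} (hj : j ≠ 1) {u : X N}
    (hc : u ∈ cell N 0) (h : f j u ∈ cell N (k + 1)) : u = a ∧ k = 0 := by
  obtain ⟨v, hv⟩ := h
  have hv : f 1 (fw (pre (wb : W N) k) v) = f j u := hv
  obtain ⟨e, rfl⟩ := f_eq_ne hj.symm hv
  refine ⟨rfl, ?_⟩
  cases k with
  | zero => rfl
  | succ k =>
    have e : f 1 (fw (pre (wb : W N) k) v) = a := e
    rw [← f_zero_b] at e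
    exact (a_ne_b (f_eq_ne l10 e).2.symm).elim

lemma Tr_stable {k m : ℕ} (hkm : k ≤ m) (h : ℕ → Ga N) {x : X N} (hx : x ∉ cell N k) :
    (Tr m h).1 x = (Tr k h).1 x := by
  induction k generalizing m h x with
  | zero => exact (hx (cell_zero x)).elim
  | succ k ih =>
    obtain ⟨m, rfl⟩ : ∃ m', m = m' + 1 := ⟨m - 1, by omega⟩
    rcases notMem_cell_succ hx with ⟨u, hu, rfl⟩ | ⟨j, u, hj, rfl⟩
    · rw [Tr_1, Tr_1, ih (by omega) _ hu]
    · by_cases h2 : j = 2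
      · subst h2; rw [Tr_2, Tr_2]
      · rw [Tr_j _ _ hj h2, Tr_j _ _ hj h2]

lemma Tr_cell (k m : ℕ) (h : ℕ → Ga N) {x : X N} (hx : x ∈ cell N k) :
    (Tr m h).1 x ∈ cell N k := by
  induction k generalizing m h x with
  | zero => exact cell_zero _
  | succ k ih =>
    cases m with
    | zero => exact hx
    | succ m =>
      obtain ⟨v, rfl⟩ := hx
      change (Tr (m + 1) h).1 (f 1 (fw (pre (wb : W N) k) v)) ∈ _
      rw [Tr_1, mem_cell_succ]
      exact ih _ _ ⟨v, rfl⟩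

lemma Tr_inv (k : ℕ) (h : ℕ → Ga N) : Tr k h⁻¹ * Tr k h = 1 := by
  rw [← Tr_mul, inv_mul_cancel]
  induction k with
  | zero => rfl
  | succ k ih =>
    apply Subtype.ext
    change blk1 _ = 1
    rw [← map_one blk1]
    congr 1
    funext i
    have ih' : Tr k (fun l => (1 : ℕ → Ga N) (l + 1)) = 1 := ih
    rw [ih']
    simp

lemma Tr_notcell (k m : ℕ) (h : ℕ → Ga N) {x : X N} (hx : x ∉ cell N k) :
    (Tr m h).1 x ∉ cell N k := by
  intro hc
  apply hx
  have := Tr_cell k m h⁻¹ hc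
  rw [← mulA] at this
  have e : ((Tr m h⁻¹).1 * (Tr m h).1) = 1 := congrArg Subtype.val (Tr_inv m h)
  rw [e] at this
  exact this

open Classical in
def FF (h : ℕ → Ga N) (x : X N) : X N :=
  if hx : ∃ k, x ∉ cell N k then (Tr (Nat.find hx) h).1 x else x

lemma FF_eq (h : ℕ → Ga N) {x : X N} {k : ℕ} (hk : x ∉ cell N k) : FF h x = (Tr k h).1 x := by
  classical
  have hx : ∃ k, x ∉ cell N k := ⟨k, hk⟩
  unfold FF
  rw [dif_pos hx]
  convert (Tr_stable (Nat.find_min' hx hk) h (Nat.find_spec hx)).symm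

lemma FF_b (h : ℕ → Ga N) : FF h b = b := by
  unfold FF
  rw [dif_neg]
  push Not
  exact b_mem_cell

lemma FF_cell (h : ℕ → Ga N) {k : ℕ} {x : X N} (hx : x ∈ cell N k) : FF h x ∈ cell N k := by
  by_cases hb : x = b
  · subst hb; rw [FF_b]; exact hx
  · obtain ⟨m, hm⟩ := exists_notMem_cell hb
    rw [FF_eq h hm]
    exact Tr_cell _ _ _ hx

lemma FF_mul (h h' : ℕ → Ga N) (x : X N) : FF h (FF h' x) = FF (h * h') x := by
  by_cases hb : x = b
  · subst hb; rw [FF_b, FF_b, FF_b]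
  · obtain ⟨m, hm⟩ := exists_notMem_cell hb
    rw [FF_eq h' hm, FF_eq h (Tr_notcell m m h' hm), FF_eq _ hm, Tr_mul]
    rfl

lemma FF_one (x : X N) : FF 1 x = x := by
  by_cases hb : x = b
  · subst hb; rw [FF_b]
  · obtain ⟨m, hm⟩ := exists_notMem_cell hb
    rw [FF_eq _ hm]
    have := Tr_inv m (1 : ℕ → Ga N)
    rw [← Tr_mul, inv_mul_cancel] at this
    rw [this]; rfl

lemma FF_1 (h : ℕ → Ga N) (u : X N) : FF h (f 1 u) = f 1 (FF (fun l => h (l + 1)) u) := by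
  by_cases hb : u = b
  · subst hb; rw [FF_b, f_one_b, FF_b]
  · obtain ⟨m, hm⟩ := exists_notMem_cell hb
    rw [FF_eq _ hm, FF_eq h (k := m + 1) (by rwa [mem_cell_succ]), Tr_1]

lemma FF_2 (h : ℕ → Ga N) (u : X N) : FF h (f 2 u) = f 2 ((h 0).1 u) := by
  have : f 2 u ∉ cell N 2 := fun hc => by
    have := (cell_succ_not (x := u) l21 (cell_zero u) hc).2
    omega
  rw [FF_eq h this, Tr_2]

lemma FF_j (h : ℕ → Ga N) {j : Fin (N + 3)} (h1 : j ≠ 1) (h2 : j ≠ 2) (u : X N) :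
    FF h (f j u) = f j u := by
  have : f j u ∉ cell N 2 := fun hc => by
    have := (cell_succ_not (x := u) h1 (cell_zero u) hc).2
    omega
  rw [FF_eq h this, Tr_j _ _ h1 h2]

lemma isOpen_f_image (i : Fin (N + 3)) {U : Set (X N)} (hU : IsOpen U) (ha : a ∉ U) :
    IsOpen (f i '' U) := by
  have : f i '' U = D i ∩ r i ⁻¹' U := by
    ext x
    constructor
    · rintro ⟨u, hu, rfl⟩
      refine ⟨mem_D.2 (fun e => ha (e ▸ hu)), ?_⟩
      rw [Set.mem_preimage, r_f]; exact hu
    · rintro ⟨⟨u, hu, rfl⟩, h⟩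
      rw [Set.mem_preimage, r_f] at h
      exact ⟨u, h, rfl⟩
  rw [this]
  exact (isOpen_D i).inter (hU.preimage (continuous_r i))

lemma cell_nhds (k : ℕ) : cell N k ∈ 𝓝 (b : X N) := by
  have key : ∃ U : Set (X N), IsOpen U ∧ b ∈ U ∧ a ∉ U ∧ U ⊆ cell N k := by
    induction k with
    | zero => exact ⟨{a}ᶜ, isOpen_compl_singleton, a_ne_b.symm, fun h => h rfl,
        fun x _ => cell_zero x⟩
    | succ k ih =>
      obtain ⟨U, h1, h2, h3, h4⟩ := ih
      refine ⟨f 1 '' U, isOpen_f_image 1 h1 h3, ⟨b, h2, f_one_b⟩, ?_, ?_⟩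
      · rintro ⟨u, hu, e⟩
        rw [← f_zero_b] at e
        exact a_ne_b (f_eq_ne l10 e).2.symm
      · rintro _ ⟨u, hu, rfl⟩
        rw [mem_cell_succ]; exact h4 hu
  obtain ⟨U, h1, h2, h3, h4⟩ := key
  exact Filter.mem_of_superset (h1.mem_nhds h2) h4

lemma FF_cont (h : ℕ → Ga N) : Continuous (FF h) := by
  rw [continuous_iff_continuousAt]
  intro x
  by_cases hb : x = b
  · subst hb
    intro U hU
    rw [FF_b] at hU
    obtain ⟨k, hk⟩ := shrink (wb : W N) hU
    rw [Filter.mem_map]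
    refine Filter.mem_of_superset (cell_nhds k) fun y hy => ?_
    exact hk k le_rfl (FF_cell h hy)
  · obtain ⟨m, hm⟩ := exists_notMem_cell hb
    have hcl : IsClosed (cell N m) := (isCompact_range (continuous_fw _)).isClosed
    have : FF h =ᶠ[𝓝 x] (Tr m h).1 :=
      Filter.mem_of_superset (hcl.isOpen_compl.mem_nhds hm) fun y hy => FF_eq h hy
    exact (Tr m h).1.continuous.continuousAt.congr (Filter.EventuallyEq.symm this)

/-- Diagonal homeomorphisms. -/
def Fh (h : ℕ → Ga N) : X N ≃ₜ X N where
  toFun := FF h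
  invFun := FF h⁻¹
  left_inv x := by rw [FF_mul, inv_mul_cancel, FF_one]
  right_inv x := by rw [FF_mul, mul_inv_cancel, FF_one]
  continuous_toFun := FF_cont h
  continuous_invFun := FF_cont _

lemma Fh_mul (h h' : ℕ → Ga N) : Fh h * Fh h' = Fh (h * h') := by
  ext1 x; exact FF_mul h h' x

lemma Fh_inv (h : ℕ → Ga N) : (Fh h)⁻¹ = Fh h⁻¹ := rfl

lemma Fh_1 (h : ℕ → Ga N) (u : X N) : Fh h (f 1 u) = f 1 (Fh (fun l => h (l + 1)) u) := FF_1 h u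
lemma Fh_2 (h : ℕ → Ga N) (u : X N) : Fh h (f 2 u) = f 2 ((h 0).1 u) := FF_2 h u
lemma Fh_j (h : ℕ → Ga N) {j : Fin (N + 3)} (h1 : j ≠ 1) (h2 : j ≠ 2) (u : X N) :
    Fh h (f j u) = f j u := FF_j h h1 h2 u

lemma Fh_a (h : ℕ → Ga N) : Fh h a = a := by
  conv_lhs => rw [← f_zero_b, Fh_j h l10.symm l20.symm]
  exact f_zero_b

/-- Shift of sequences. -/
def shf (h : ℕ → Ga N) : ℕ → Ga N := fun k => Nat.casesOn k 1 h

lemma sh_Fh (h : ℕ → Ga N) : sh * Fh h = Fh (shf h) * sh := by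
  have e : (fun l => shf h (l + 1)) = h := rfl
  apply ext_cells
  intro i u
  rw [mulA, mulA]
  by_cases h1 : i = 1
  · subst h1
    rw [Fh_1, sh_f l10, sh_f l10, Fh_1, e, Fh_1]
  by_cases h2 : i = 2
  · subst h2
    rw [Fh_2, sh_f l20, sh_f l20, Fh_1, e, Fh_2]
  rw [Fh_j h h1 h2]
  by_cases h0 : i = 0
  · subst h0
    obtain ⟨j, v, rfl⟩ := exists_f u
    by_cases j1 : j = 1
    · subst j1
      rw [sh_01, Fh_j _ h1 h2]
    by_cases j0 : j = 0
    · subst j0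
      rw [sh_00, Fh_1, e, Fh_j _ h1 h2]
    rw [sh_0j j0 j1]
    by_cases j2 : j = 2
    · subst j2
      rw [Fh_2]; rfl
    · rw [Fh_j _ j1 j2]
  · rw [sh_f h0, Fh_1, e, Fh_j _ h1 h2]

/-- Constant diagonal. -/
def AA (g : Ga N) : Ga N := ⟨Fh (fun _ => g), Fh_a _⟩

lemma comm_AA (g : Ga N) : AA g * shG * (AA g)⁻¹ * shG⁻¹ = io2 g := by
  apply Subtype.ext
  change Fh (fun _ => g) * sh * Fh (fun _ => g)⁻¹ * sh⁻¹ = iota 2 g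
  rw [mul_assoc (Fh _) sh, sh_Fh, ← mul_assoc, mul_assoc, mul_inv_cancel, mul_one, Fh_mul]
  apply ext_cells
  intro i u
  by_cases h1 : i = 1
  · subst h1
    rw [Fh_1, iota_f_ne l21.symm]
    congr 1
    have : (fun l => ((fun _ => g : ℕ → Ga N) * shf (fun _ => g)⁻¹) (l + 1)) = (1 : ℕ → Ga N) := by
      funext l
      exact mul_inv_cancel g
    rw [this]
    exact FF_one u
  by_cases h2 : i = 2
  · subst h2
    rw [Fh_2, iota_f]
    have : ((fun _ => g : ℕ → Ga N) * shf (fun _ => g)⁻¹) 0 = g := mul_one g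
    rw [this]
  · rw [Fh_j _ h1 h2, iota_f_ne h2]

lemma acts_conj {e e' : X N → X N} {g g' k k' τ h : X N ≃ₜ X N}
    (h1 : ∀ u, k (e u) = e (g u)) (h2 : ∀ x, x ∉ Set.range e → k x = x)
    (h3 : ∀ u, k' (e' u) = e' (g' u)) (h4 : ∀ x, x ∉ Set.range e' → k' x = x)
    (h5 : ∀ u, τ (e u) = e' (h u)) (h6 : g' * h = h * g) : τ * k * τ⁻¹ = k' := by
  rw [mul_inv_eq_iff_eq_mul]
  ext1 x
  rw [mulA, mulA]
  by_cases hx : x ∈ Set.range e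
  · obtain ⟨u, rfl⟩ := hx
    rw [h1, h5, h5, h3, ← mulA, ← mulA, h6]
  · rw [h2 x hx, h4]
    rintro ⟨w, hw⟩
    rw [← invA' h w, ← h5] at hw
    exact hx ⟨_, τ.injective hw⟩

lemma iota_off {i : Fin (N + 3)} (g : Ga N) (x : X N) (hx : x ∉ Set.range (f i)) :
    iota i g x = x := by
  obtain ⟨j, u, rfl⟩ := exists_f x
  have : j ≠ i := by rintro rfl; exact hx ⟨u, rfl⟩
  exact iota_f_ne this g u

lemma sh_pow_f' (k : ℕ) (u : X N) : (sh ^ (k + 1)) (f 2 u) = f 1 ((sh ^ k) (f 2 u)) := by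
  induction k with
  | zero => rw [zero_add, pow_one, sh_f l20]; rfl
  | succ k ih => rw [pow_succ', mulA, ih, sh_f l10, ← ih]

lemma sh_pow_f (k : ℕ) (u : X N) (v : ℕ → Ga N) : (Fh v) ((sh ^ k) (f 2 u)) =
    (sh ^ k) (f 2 ((v k).1 u)) := by
  induction k generalizing u v with
  | zero => exact Fh_2 v u
  | succ k ih => rw [sh_pow_f', Fh_1, ih, sh_pow_f']

/-- The finitely generated dense group, given a sequence in `Ga`. -/
def GG (g : ℕ → Ga N) : Subgroup (X N ≃ₜ X N) :=
  Subgroup.closure ({sh, iota 2 shG, Fh (fun k => AA (g k))} ∪ Set.range sig)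

lemma GG_fg (g : ℕ → Ga N) : (GG g).FG := by
  rw [Subgroup.fg_iff]
  refine ⟨_, rfl, ?_⟩
  exact (Set.toFinite _).union (Set.finite_range _)

lemma sh_mem (g : ℕ → Ga N) : sh ∈ GG g :=
  Subgroup.subset_closure (Or.inl (by simp))

lemma sig_mem (g : ℕ → Ga N) (π : Equiv.Perm (Fin (N + 3))) : sig π ∈ GG g :=
  Subgroup.subset_closure (Or.inr ⟨π, rfl⟩)

lemma iota_mem_GG (g : ℕ → Ga N) (k : ℕ) (i : Fin (N + 3)) : iota i (g k) ∈ GG g := by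
  set F := Fh (fun k => AA (g k)) with hF
  have hFm : F ∈ GG g := Subgroup.subset_closure (Or.inl (by simp [hF]))
  have htm : iota 2 shG ∈ GG g := Subgroup.subset_closure (Or.inl (by simp))
  set F' := (sh ^ k)⁻¹ * F * sh ^ k with hF'
  have hF'm : F' ∈ GG g :=
    mul_mem (mul_mem (inv_mem (pow_mem (sh_mem g) k)) hFm) (pow_mem (sh_mem g) k)
  have h1 : ∀ u, F' (f 2 u) = f 2 ((AA (g k)).1 u) := by
    intro u
    rw [hF', mulA, mulA, hF, sh_pow_f, invA]
  have h2 : F' * iota 2 shG * F'⁻¹ = iota 2 (AA (g k) * shG * (AA (g k))⁻¹) := by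
    refine acts_conj (e := f 2) (e' := f 2) (g := shG.1) (g' := (AA (g k) * shG * (AA (g k))⁻¹).1)
      (h := (AA (g k)).1) (iota_f 2 _) (iota_off _) (iota_f 2 _) (iota_off _) h1 ?_
    change ((AA (g k) * shG * (AA (g k))⁻¹ * AA (g k) : Ga N) : X N ≃ₜ X N) =
      (AA (g k) * shG : Ga N)
    rw [inv_mul_cancel_right]
  have h3 : iota 2 (io2 (g k)) ∈ GG g := by
    rw [← comm_AA, map_mul, ← h2, map_inv]
    exact mul_mem (mul_mem (mul_mem hF'm htm) (inv_mem hF'm)) (inv_mem htm)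
  have h4 : (sh * sig (Equiv.swap 0 2)) * iota 2 (io2 (g k)) * (sh * sig (Equiv.swap 0 2))⁻¹ =
      iota 2 (g k) := by
    refine acts_conj (e := fun u => f 2 (f 2 u)) (e' := f 2) (g := (g k).1) (g' := (g k).1)
      (h := 1) ?_ ?_ (iota_f 2 _) (iota_off _) ?_ (by rw [one_mul, mul_one])
    · intro u
      rw [iota_f]
      congr 1
      exact iota_f 2 _ _
    · intro x hx
      obtain ⟨j, u, rfl⟩ := exists_f x
      by_cases hj : j = 2
      · subst hj
        rw [iota_f]
        congr 1
        apply iota_off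
        rintro ⟨v, rfl⟩
        exact hx ⟨v, rfl⟩
      · exact iota_f_ne hj _ _
    · intro u
      rw [mulA, sig_f, Equiv.swap_apply_right, sh_0j l20 l21]
      rfl
  have h5 : iota 2 (g k) ∈ GG g := by
    rw [← h4]
    have := mul_mem (sh_mem g) (sig_mem g (Equiv.swap 0 2))
    exact mul_mem (mul_mem this h3) (inv_mem this)
  have h6 : sig (Equiv.swap 2 i) * iota 2 (g k) * (sig (Equiv.swap 2 i))⁻¹ = iota i (g k) := by
    refine acts_conj (e := f 2) (e' := f i) (g := (g k).1) (g' := (g k).1)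
      (h := 1) (iota_f 2 _) (iota_off _) (iota_f i _) (iota_off _) ?_ (by rw [one_mul, mul_one])
    intro u
    rw [sig_f, Equiv.swap_apply_left]; rfl
  rw [← h6]
  exact mul_mem (mul_mem (sig_mem g _) h5) (inv_mem (sig_mem g _))

end homeos
end Waz

open Topology
set_option linter.unusedSectionVars false
set_option linter.unusedVariables false

namespace Waz

section dens
variable {N : ℕ}

lemma HasReps.homeo {Y : Type*} [TopologicalSpace Y] {p : Y} {m : ℕ} (hr : HasReps p m)
    (h : Y ≃ₜ Y) : HasReps (h p) m := by
  obtain ⟨x, h1, h2, h3⟩ := hr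
  refine ⟨fun i => h (x i), fun i e => h1 i (h.injective e), fun i j e => ?_, fun y hy => ?_⟩
  · exact h2 i j ((same_homeo_iff h).1 e)
  · obtain ⟨i, hi⟩ := h3 (h.symm y) (fun e => hy (by rw [← e, h.apply_symm_apply]))
    refine ⟨i, ?_⟩
    rw [← h.apply_symm_apply y, same_homeo_iff]
    exact hi

/-- Reachable points from `c` by homeomorphisms fixing `a`. -/
def Rch (x : X N) : Prop := ∃ g : Ga N, g.1 c = x

lemma Rch.of {x y : X N} (h : Rch x) (g : Ga N) (e : g.1 x = y) : Rch y := by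
  obtain ⟨k, hk⟩ := h
  refine ⟨g * k, ?_⟩
  rw [← e, ← hk]; rfl

lemma Rch.back {x y : X N} (h : Rch y) (g : Ga N) (e : g.1 x = y) : Rch x := by
  refine h.of g⁻¹ ?_
  rw [← e]; exact invA g.1 x

lemma rch_one {i : Fin (N + 3)} (hi : i ≠ 0) : Rch (f i c : X N) := by
  have h1 : Rch (f 1 c : X N) := ⟨shG, sh_c⟩
  refine h1.of ⟨sig (Equiv.swap 1 i), ?_⟩ (y := f i c) ?_
  · change sig _ a = a
    rw [← f_zero_b, sig_f, Equiv.swap_apply_of_ne_of_ne l10.symm hi.symm]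
  · change sig _ _ = _
    rw [sig_f, Equiv.swap_apply_left]

lemma rch_cons {i : Fin (N + 3)} (hi : i ≠ 0) {x : X N} (h : Rch x) : Rch (f i x) := by
  obtain ⟨g, hg⟩ := h
  refine (rch_one hi).of ⟨iota i g, iota_mem hi g⟩ ?_
  change iota i g _ = _
  rw [iota_f, hg]

lemma rho_fw (w : List (Fin (N + 3))) : ∃ w', w'.length = w.length ∧
    rho (fw w c : X N) = fw w' c := by
  cases w with
  | nil =>
    refine ⟨[], rfl, ?_⟩
    change rho c = c
    conv_lhs => rw [← f_a 0]
    unfold rho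
    rw [sig_f, f_a]
  | cons i w => exact ⟨Equiv.swap 0 1 i :: w, rfl, sig_f _ _ _⟩

lemma rch_fw (n : ℕ) : ∀ w : List (Fin (N + 3)), w.length = n → Rch (fw w c : X N) := by
  induction n using Nat.strong_induction_on with
  | _ n ih =>
    intro w hw
    cases w with
    | nil => exact ⟨1, rfl⟩
    | cons i w =>
      simp only [List.length_cons] at hw
      by_cases hi : i = 0
      · subst hi
        cases w with
        | nil =>
          change Rch (f 0 c)
          rw [← f_a 1]
          refine Rch.back (y := c) ⟨1, rfl⟩ shG ?_
          change sh _ = _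
          rw [sh_01, f_a]
        | cons j u =>
          simp only [List.length_cons] at hw
          change Rch (f 0 (f j (fw u c)))
          by_cases h1 : j = 1
          · subst h1
            exact Rch.back (ih (u.length + 1) (by omega) (0 :: u) rfl) shG (sh_01 _)
          by_cases h0 : j = 0
          · subst h0
            obtain ⟨u', hu', he⟩ := rho_fw u
            have h2 : Rch (f 0 (fw u' c)) := ih (u.length + 1) (by omega) (0 :: u') (by simp [hu'])
            refine Rch.back (rch_cons l10 h2) shG ?_
            change sh _ = _
            rw [sh_00, he]
          · exact Rch.back (ih (u.length + 1) (by omega) (j :: u) rfl) shG (sh_0j h0 h1 _)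
      · exact rch_cons hi (ih _ (by omega) w rfl)

lemma stab_c_aux {h : X N ≃ₜ X N} (hc : h c = c) :
    ∃ π : Fin (N + 3) → Fin (N + 3), ∀ i u, ∃ v, h (f i u) = f (π i) v := by
  have hne : ∀ i, h (f i b) ≠ c := by
    intro i e
    rw [← hc] at e
    have := h.injective e
    rw [f_eq_c] at this
    exact a_ne_b this.symm
  choose π hπ using fun i => exists_D (hne i)
  refine ⟨π, fun i u => ?_⟩
  by_cases hu : u = a
  · subst hu
    exact ⟨a, by rw [f_a, f_a, hc]⟩
  · have h1 : Same c (f i b) (f i u) := (same_c (mem_D.2 a_ne_b.symm)).2 (mem_D.2 hu)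
    have h2 := h1.homeo h
    rw [hc, same_c (hπ i)] at h2
    obtain ⟨v, _, hv⟩ := h2
    exact ⟨v, hv.symm⟩

lemma stab_c_inj {h h' : X N ≃ₜ X N} (hh : ∀ x, h' (h x) = x) {π π' : Fin (N + 3) → Fin (N + 3)}
    (hπ : ∀ i u, ∃ v, h (f i u) = f (π i) v) (hπ' : ∀ i u, ∃ v, h' (f i u) = f (π' i) v)
    (i : Fin (N + 3)) : π' (π i) = i := by
  by_contra hne
  obtain ⟨v, hv⟩ := hπ i b
  obtain ⟨v', hv'⟩ := hπ' (π i) v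
  rw [← hv, hh] at hv'
  exact a_ne_b (f_eq_ne (Ne.symm hne) hv').1.symm

lemma stab_c {h : X N ≃ₜ X N} (hc : h c = c) : ∃ π g, h = blk π g := by
  have hc' : h⁻¹ c = c := by conv_lhs => rw [← hc]; exact invA h c
  obtain ⟨π, hπ⟩ := stab_c_aux hc
  obtain ⟨π', hπ'⟩ := stab_c_aux hc'
  have e1 := stab_c_inj (invA h) hπ hπ'
  have e2 := stab_c_inj (invA' h) hπ' hπ
  have k1 : ∀ i u, f (π i) (r (π i) (h (f i u))) = h (f i u) := by
    intro i u
    obtain ⟨v, hv⟩ := hπ i u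
    rw [hv, r_f]
  have k2 : ∀ i u, f i (r i (h⁻¹ (f (π i) u))) = h⁻¹ (f (π i) u) := by
    intro i u
    obtain ⟨v, hv⟩ := hπ' (π i) u
    rw [hv, e1, r_f]
  let g : Fin (N + 3) → X N ≃ₜ X N := fun i =>
    { toFun := fun u => r (π i) (h (f i u))
      invFun := fun u => r i (h⁻¹ (f (π i) u))
      left_inv := fun u => by
        change r i (h⁻¹ (f (π i) (r (π i) (h (f i u))))) = u
        rw [k1, invA, r_f]
      right_inv := fun u => by
        change r (π i) (h (f i (r i (h⁻¹ (f (π i) u))))) = u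
        rw [k2, invA', r_f]
      continuous_toFun := (continuous_r _).comp (h.continuous.comp (continuous_f _))
      continuous_invFun := (continuous_r _).comp (h⁻¹.continuous.comp (continuous_f _)) }
  have hg : ∀ i, g i a = a := by
    intro i
    change r (π i) (h (f i a)) = a
    rw [f_a, hc, ← f_a (π i), r_f]
  refine ⟨⟨π, π', e1, e2⟩, fun i => ⟨g i, hg i⟩, ?_⟩
  apply ext_cells
  intro i u
  rw [blk_f]
  exact (k1 i u).symm

lemma cont_coe {Y : Type*} [TopologicalSpace Y] :
    Continuous (fun h : Y ≃ₜ Y => (h : C(Y, Y))) := continuous_induced_dom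

lemma cont_eval {Y : Type*} [TopologicalSpace Y] [LocallyCompactSpace Y] :
    Continuous (fun q : (Y ≃ₜ Y) × Y => q.1 q.2) := by
  have h : Continuous (fun q : (Y ≃ₜ Y) × Y => ((q.1 : C(Y, Y)), q.2)) :=
    (cont_coe.comp continuous_fst).prodMk continuous_snd
  have e : Continuous (fun q : C(Y, Y) × Y => q.1 q.2) := ContinuousEval.continuous_eval
  exact e.comp h

lemma cont_iota (i : Fin (N + 3)) : Continuous (fun g : Ga N => iota i g) := by
  rw [continuous_induced_rng]
  apply ContinuousMap.continuous_of_continuous_uncurry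
  have hl : LocallyFinite (fun j : Fin (N + 3) =>
      ((Set.univ : Set (Ga N)) ×ˢ Set.range (f j : X N → X N))) := locallyFinite_of_finite _
  refine hl.continuous ?_ (fun j => isClosed_univ.prod (isClosed_range_f j)) fun j => ?_
  · rw [Set.eq_univ_iff_forall]
    rintro ⟨g, x⟩
    obtain ⟨j, u, rfl⟩ := exists_f x
    exact Set.mem_iUnion.2 ⟨j, trivial, u, rfl⟩
  · by_cases hj : j = i
    · subst hj
      have hc : Continuous (fun q : Ga N × X N => f j (q.1.1 (r j q.2))) :=
        (continuous_f j).comp (cont_eval.comp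
          ((continuous_subtype_val.comp continuous_fst).prodMk
            ((continuous_r j).comp continuous_snd)))
      refine hc.continuousOn.congr ?_
      rintro ⟨g, x⟩ ⟨_, u, rfl⟩
      change iota j g (f j u) = f j (g.1 (r j (f j u)))
      rw [iota_f, r_f]
    · refine continuous_snd.continuousOn.congr ?_
      rintro ⟨g, x⟩ ⟨_, u, rfl⟩
      exact iota_f_ne hj g u

lemma cont_mul {Y : Type*} [TopologicalSpace Y] [LocallyCompactSpace Y] :
    ContinuousMul (Y ≃ₜ Y) := by
  constructor
  rw [continuous_induced_rng]
  have h : Continuous (fun q : (Y ≃ₜ Y) × (Y ≃ₜ Y) => (q.1 : C(Y, Y)).comp (q.2 : C(Y, Y))) :=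
    (cont_coe.comp continuous_fst).compCM (cont_coe.comp continuous_snd)
  exact h

theorem dense_GG (g : ℕ → Ga N) (hg : DenseRange g) : Dense (GG g : Set (X N ≃ₜ X N)) := by
  have := cont_mul (Y := X N)
  let M : Submonoid (X N ≃ₜ X N) := (GG g).toSubmonoid.topologicalClosure
  have hle : ∀ x ∈ GG g, x ∈ M := fun x hx => subset_closure hx
  have hiota : ∀ i h, iota i h ∈ M := by
    intro i h
    have h1 : iota i h ∈ closure ((fun h : Ga N => iota i h) '' Set.range g) :=
      (cont_iota i).range_subset_closure_image_dense hg ⟨h, rfl⟩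
    refine closure_mono ?_ h1
    rintro _ ⟨_, ⟨k, rfl⟩, rfl⟩
    exact iota_mem_GG g k i
  have hblk1 : ∀ h, blk1 h ∈ M := by
    intro h
    exact Submonoid.pi_mem_of_mulSingle_mem (H := M.comap blk1) h (fun i => hiota i (h i))
  have hblk : ∀ π h, blk π h ∈ M := by
    intro π h
    have : blk π h = sig π * blk1 h := by
      apply ext_cells
      intro i u
      rw [mulA, blk1_f, sig_f, blk_f]
    rw [this]
    exact mul_mem (hle _ (sig_mem g π)) (hblk1 h)
  have hstab : ∀ h : X N ≃ₜ X N, h c = c → h ∈ M := by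
    intro h hc
    obtain ⟨π, k, rfl⟩ := stab_c hc
    exact hblk π k
  have hall : ∀ h, h ∈ M := by
    intro h
    obtain ⟨v, hv⟩ := branch_of_order ((hasReps_c (N := N)).homeo h).ptOrder
    cases v with
    | nil => exact hstab h hv
    | cons i v =>
      obtain ⟨g', hg'⟩ := rch_fw v.length v rfl
      set k := blk (Equiv.swap 1 i) (fun _ => g') * sh with hk
      have h1 : k c = h c := by
        rw [hk, mulA, sh_c, blk_f, Equiv.swap_apply_left, hg', hv]
        rfl
      have h2 : k⁻¹ * h ∈ M := by
        apply hstab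
        rw [mulA, ← h1, invA]
      have h3 : h = k * (k⁻¹ * h) := by rw [mul_inv_cancel_left]
      rw [h3]
      exact mul_mem (mul_mem (hblk _ _) (hle _ (sh_mem g))) h2
  intro h
  exact hall h

lemma exists_dense_Ga : ∃ s : Set (Ga N), s.Countable ∧ Dense s := by
  have : SecondCountableTopology (X N ≃ₜ X N) :=
    TopologicalSpace.secondCountableTopology_induced _ C(X N, X N) _
  have : SecondCountableTopology (Ga N) :=
    TopologicalSpace.Subtype.secondCountableTopology (Ga N : Set (X N ≃ₜ X N))
  exact TopologicalSpace.exists_countable_dense (Ga N)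

end dens
end Waz

open Topology
set_option linter.unusedSectionVars false
set_option linter.unusedVariables false

namespace Waz

section abel
variable {N : ℕ}

lemma join_abelian {Γ Δ : Type*} [Group Γ] [Group Δ] (D : Δ →* Γ) (hD : Function.Injective D)
    (σ : Γ) (hc : ∀ x, Commute σ (D x)) (hd : ∀ (j : ℤ) x, σ ^ j = D x → x = 1)
    (A : Subgroup Δ) (hA : ∀ x ∈ A, ∀ y ∈ A, x * y = y * x) :
    ∃ K : Subgroup Γ, Nat.card K = orderOf σ * Nat.card A ∧ (∀ x ∈ K, ∀ y ∈ K, x * y = y * x) ∧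
      ∀ k ∈ K, ∃ (j : ℤ) (x : Δ), x ∈ A ∧ k = σ ^ j * D x := by
  have hcomm : ∀ (m : Subgroup.zpowers σ) (x : A),
      Commute ((Subgroup.zpowers σ).subtype m) ((D.comp A.subtype) x) := by
    rintro ⟨_, j, rfl⟩ x
    exact (hc x.1).zpow_left j
  let φ := MonoidHom.noncommCoprod (Subgroup.zpowers σ).subtype (D.comp A.subtype) hcomm
  have hφ : Function.Injective φ := by
    rw [injective_iff_map_eq_one]
    rintro ⟨⟨_, j, rfl⟩, x⟩ h
    have h' : σ ^ j * D x.1 = 1 := h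
    have h2 : σ ^ j = D (x.1⁻¹) := by rw [map_inv]; exact eq_inv_of_mul_eq_one_left h'
    have h3 := hd _ _ h2
    rw [h3, map_one] at h2
    rw [inv_eq_one] at h3
    have h4 : x = 1 := Subtype.ext h3
    have h5 : (⟨(fun z : ℤ => σ ^ z) j, j, rfl⟩ : Subgroup.zpowers σ) = 1 := Subtype.ext h2
    rw [h4, h5]; rfl
  refine ⟨φ.range, ?_, ?_, ?_⟩
  · rw [← Nat.card_zpowers, ← Nat.card_prod]
    exact (Nat.card_congr (MonoidHom.ofInjective hφ).toEquiv).symm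
  · rintro _ ⟨x, rfl⟩ _ ⟨y, rfl⟩
    rw [← map_mul, ← map_mul]
    congr 1
    obtain ⟨⟨_, j, rfl⟩, x⟩ := x
    obtain ⟨⟨_, k, rfl⟩, y⟩ := y
    refine Prod.ext ?_ ?_
    · exact Subtype.ext (Commute.zpow_zpow_self σ j k)
    · exact Subtype.ext (hA _ x.2 _ y.2)
  · rintro _ ⟨⟨⟨_, j, rfl⟩, x⟩, rfl⟩
    exact ⟨j, x, x.2, rfl⟩

/-- Simultaneous action on the cells in `S`. -/
noncomputable def DS (S : Fin (N + 3) → Prop) [DecidablePred S] : Ga N →* (X N ≃ₜ X N) :=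
  blk1.comp
    { toFun := fun x i => if S i then x else 1
      map_one' := by funext i; simp
      map_mul' := by
        intro x y; funext i
        simp only [Pi.mul_apply]
        split_ifs <;> simp }

lemma DS_pos (S : Fin (N + 3) → Prop) [DecidablePred S] (x : Ga N) {i : Fin (N + 3)} (hi : S i)
    (u : X N) : DS S x (f i u) = f i (x.1 u) := by
  simp [DS, blk1_f, hi]

lemma DS_neg (S : Fin (N + 3) → Prop) [DecidablePred S] (x : Ga N) {i : Fin (N + 3)} (hi : ¬ S i)
    (u : X N) : DS S x (f i u) = f i u := by
  simp [DS, blk1_f, hi]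

lemma eq_one_of_fix {x : Ga N} (h : ∀ u, x.1 u = u) : x = 1 :=
  Subtype.ext (Homeomorph.ext h)

lemma DS_inj (S : Fin (N + 3) → Prop) [DecidablePred S] (h1 : S 1) :
    Function.Injective (DS (N := N) S) := by
  rw [injective_iff_map_eq_one]
  intro x hx
  apply eq_one_of_fix
  intro u
  apply f_inj 1
  rw [← DS_pos S x h1, hx]; rfl

lemma DS_comm (S : Fin (N + 3) → Prop) [DecidablePred S] (π : Equiv.Perm (Fin (N + 3)))
    (hπ : ∀ i, S (π i) ↔ S i) (x : Ga N) : Commute (sig π) (DS S x) := by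
  apply ext_cells
  intro i u
  rw [mulA, mulA, sig_f]
  by_cases h : S i
  · rw [DS_pos S x h, DS_pos S x ((hπ i).2 h), sig_f]
  · rw [DS_neg S x h, DS_neg S x (fun h' => h ((hπ i).1 h')), sig_f]

lemma DS_disj (S : Fin (N + 3) → Prop) [DecidablePred S] (h1 : S 1)
    (π : Equiv.Perm (Fin (N + 3))) (x : Ga N) (h : sig π = DS S x) : x = 1 := by
  have key : ∀ u, f (π 1) u = f 1 (x.1 u) := by
    intro u
    rw [← DS_pos S x h1, ← h, sig_f]
  have h2 : π 1 = 1 := by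
    by_contra hne
    exact a_ne_b (f_eq_ne hne (key b)).1.symm
  apply eq_one_of_fix
  intro u
  have := key u
  rw [h2] at this
  exact (f_inj 1 this).symm

lemma sig_inj : Function.Injective (sig (N := N)) := by
  rw [injective_iff_map_eq_one]
  intro π h
  ext1 i
  by_contra hne
  have h2 : f (π i) (b : X N) = f i b := by rw [← sig_f, h]; rfl
  exact a_ne_b (f_eq_ne hne h2).1.symm

lemma exists_perm (q k : ℕ) (hq : q.Prime) (hk : q ≤ k) :
    ∃ π : Equiv.Perm (Fin k), orderOf π = q := by
  have : Fact q.Prime := ⟨hq⟩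
  apply exists_prime_orderOf_dvd_card q
  rw [Fintype.card_perm, Fintype.card_fin]
  exact (hq.dvd_factorial).2 hk

lemma exists_abelian_smooth (m : ℕ) (hm : 0 < m) (hs : ∀ q : ℕ, q.Prime → q ∣ m → q ≤ N + 2) :
    ∃ A : Subgroup (Ga N), Nat.card A = m ∧ ∀ x ∈ A, ∀ y ∈ A, x * y = y * x := by
  induction m using induction_on_primes with
  | zero => omega
  | one =>
    refine ⟨⊥, by simp, ?_⟩
    intro x hx y hy
    rw [Subgroup.mem_bot] at hx hy
    rw [hx, hy]
  | prime_mul q m hq ih =>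
    obtain ⟨A, hA, hAc⟩ := ih (Nat.pos_of_mul_pos_left hm)
      (fun p hp hd => hs p hp (hd.mul_left q))
    obtain ⟨π₀, hπ₀⟩ := exists_perm q (N + 2) hq (hs q hq (dvd_mul_right _ _))
    let ι : Fin (N + 2) ↪ Fin (N + 3) := ⟨Fin.succ, Fin.succ_injective _⟩
    let π := Equiv.Perm.viaEmbeddingHom ι π₀
    have hπ : orderOf π = q := by
      rw [← hπ₀]
      exact orderOf_injective _ (Equiv.Perm.viaEmbeddingHom_injective ι) π₀
    have hπ0 : π 0 = 0 := by
      apply Equiv.Perm.viaEmbedding_apply_of_notMem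
      rintro ⟨j, hj⟩
      exact Fin.succ_ne_zero j hj
    have hσ : sig π ∈ Ga N := by
      change sig π a = a
      rw [← f_zero_b, sig_f, hπ0]
    have hSm : ∀ x, DS (N := N) (fun i => i ≠ 0) x ∈ Ga N := by
      intro x
      change DS (fun i => i ≠ 0) x a = a
      rw [← f_zero_b, DS_neg _ x (fun h => h rfl)]
    obtain ⟨K, hK1, hK2, -⟩ := join_abelian ((DS (N := N) (fun i => i ≠ 0)).codRestrict (Ga N) hSm)
      (fun x y h => DS_inj _ l10 (congrArg Subtype.val h)) ⟨sig π, hσ⟩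
      (fun x => Subtype.ext (DS_comm (fun i => i ≠ 0) π (fun i => by
        rw [not_iff_not]
        constructor
        · intro h; apply π.injective; rw [h, hπ0]
        · rintro rfl; exact hπ0) x))
      (fun j x h => DS_disj (fun i => i ≠ 0) l10 (π ^ j) x (by
        have := congrArg Subtype.val h
        rw [map_zpow]
        exact this)) A hAc
    refine ⟨K, ?_, hK2⟩
    rw [hK1, hA]
    congr 1
    rw [← hπ, ← orderOf_injective sig sig_inj π]
    exact (orderOf_injective (Ga N).subtype (Ga N).subtype_injective ⟨sig π, hσ⟩).symm

lemma exists_seq : ∃ (g : ℕ → Ga N) (A : ℕ → Subgroup (Ga N)), DenseRange g ∧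
    (∀ m x, x ∈ A m → x ∈ Set.range g) ∧
    ∀ m, 0 < m → (∀ q : ℕ, q.Prime → q ∣ m → q ≤ N + 2) →
      Nat.card (A m) = m ∧ ∀ x ∈ A m, ∀ y ∈ A m, x * y = y * x := by
  classical
  have h1 : ∀ m : ℕ, ∃ A : Subgroup (Ga N), (A : Set (Ga N)).Countable ∧
      (0 < m → (∀ q : ℕ, q.Prime → q ∣ m → q ≤ N + 2) →
      Nat.card A = m ∧ ∀ x ∈ A, ∀ y ∈ A, x * y = y * x) := by
    intro m
    by_cases h : 0 < m ∧ (∀ q : ℕ, q.Prime → q ∣ m → q ≤ N + 2)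
    · obtain ⟨A, hA, hA'⟩ := exists_abelian_smooth m h.1 h.2
      refine ⟨A, ?_, fun _ _ => ⟨hA, hA'⟩⟩
      have : Finite A := Nat.finite_of_card_ne_zero (by rw [hA]; exact h.1.ne')
      exact (Set.toFinite (A : Set (Ga N))).countable
    · refine ⟨⊥, by simp, fun h1 h2 => (h ⟨h1, h2⟩).elim⟩
  choose A hA1 hA2 using h1
  obtain ⟨s, hs1, hs2⟩ := exists_dense_Ga (N := N)
  have hQ : (s ∪ ⋃ m, (A m : Set (Ga N))).Countable := hs1.union (Set.countable_iUnion hA1)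
  obtain ⟨g, hg⟩ := hQ.exists_eq_range ⟨1, Or.inr (Set.mem_iUnion.2 ⟨0, one_mem _⟩)⟩
  refine ⟨g, A, ?_, ?_, hA2⟩
  · refine hs2.mono ?_
    rw [← hg]; exact Set.subset_union_left
  · intro m x hx
    rw [← hg]
    exact Or.inr (Set.mem_iUnion.2 ⟨m, hx⟩)

lemma exists_abelian_G {g : ℕ → Ga N} {A : ℕ → Subgroup (Ga N)}
    (hAg : ∀ m x, x ∈ A m → x ∈ Set.range g)
    (hA : ∀ m, 0 < m → (∀ q : ℕ, q.Prime → q ∣ m → q ≤ N + 2) →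
      Nat.card (A m) = m ∧ ∀ x ∈ A m, ∀ y ∈ A m, x * y = y * x)
    (m : ℕ) (hm : 0 < m) (hs : ∀ q : ℕ, q.Prime → q ∣ m → q ≤ N + 3)
    (hn : (N + 3).Prime → ¬ (N + 3) ^ 2 ∣ m) :
    ∃ K : Subgroup (X N ≃ₜ X N), K ≤ GG g ∧ Nat.card K = m ∧ ∀ x ∈ K, ∀ y ∈ K, x * y = y * x := by
  classical
  have hio : ∀ m x, x ∈ A m → ∀ i, iota i x ∈ GG g := by
    intro m x hx i
    obtain ⟨k, rfl⟩ := hAg m x hx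
    exact iota_mem_GG g k i
  by_cases hp : (N + 3).Prime ∧ (N + 3) ∣ m
  · obtain ⟨hp, m', rfl⟩ := hp
    have hm' : 0 < m' := Nat.pos_of_mul_pos_left hm
    obtain ⟨h1, h2⟩ := hA m' hm' (fun q hq hd => by
      have h3 := hs q hq (hd.mul_left _)
      have : q ≠ N + 3 := by
        rintro rfl
        apply hn hp
        rw [sq]
        exact mul_dvd_mul_left _ hd
      omega)
    obtain ⟨π, hπ⟩ := exists_perm (N + 3) (N + 3) hp le_rfl
    obtain ⟨K, hK1, hK2, hK3⟩ := join_abelian (DS (N := N) (fun _ => True))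
      (DS_inj _ trivial) (sig π) (DS_comm _ π (fun _ => Iff.rfl))
      (fun j x h => DS_disj (fun _ => True) trivial (π ^ j) x (by rw [map_zpow]; exact h))
      (A m') h2
    refine ⟨K, ?_, ?_, hK2⟩
    · intro k hk
      obtain ⟨j, x, hx, rfl⟩ := hK3 k hk
      refine mul_mem (zpow_mem (sig_mem g π) j) ?_
      have : DS (fun _ => True) x = blk1 (fun _ => x) := by
        simp [DS]
      rw [this]
      exact Submonoid.pi_mem_of_mulSingle_mem (H := (GG g).toSubmonoid.comap blk1) (fun _ => x)
        (fun i => hio m' x hx i)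
    · rw [hK1, h1, orderOf_injective sig sig_inj, hπ]
  · obtain ⟨h1, h2⟩ := hA m hm (fun q hq hd => by
      have h3 := hs q hq hd
      have : q ≠ N + 3 := by
        rintro rfl
        exact hp ⟨hq, hd⟩
      omega)
    have hinj : Function.Injective (iota (N := N) 2) := by
      rw [injective_iff_map_eq_one]
      intro x hx
      apply eq_one_of_fix
      intro u
      apply f_inj 2
      rw [← iota_f, hx]; rfl
    refine ⟨(A m).map (iota 2), ?_, ?_, ?_⟩
    · rintro _ ⟨x, hx, rfl⟩
      exact hio m x hx 2
    · exact (Nat.card_congr ((A m).equivMapOfInjective _ hinj).toEquiv).symm.trans h1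
    · rintro _ ⟨x, hx, rfl⟩ _ ⟨y, hy, rfl⟩
      rw [← map_mul, ← map_mul, h2 x hx y hy]

end abel
end Waz

theorem statement13 (n : ℕ) (hn : 3 ≤ n) :
    ∃ (X : Type) (_ : TopologicalSpace X) (_ : IsWazewskiDendrite n X)
      (G : Subgroup (X ≃ₜ X)),
      G.FG ∧ Dense (G : Set (X ≃ₜ X)) ∧
      (∀ H : Subgroup G, (H : Set G).Finite →
        (∀ q : ℕ, q.Prime → q ∣ Nat.card H → q ≤ n) ∧
        (n.Prime → ¬ (n ^ 2 ∣ Nat.card H))) ∧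
      ∀ m : ℕ, 0 < m → (∀ q : ℕ, q.Prime → q ∣ m → q ≤ n) →
        (n.Prime → ¬ (n ^ 2 ∣ m)) →
        ∃ H : Subgroup G, Nat.card H = m ∧ ∀ a ∈ H, ∀ b ∈ H, a * b = b * a := by
  obtain ⟨N, rfl⟩ : ∃ N, n = N + 3 := ⟨n - 3, by omega⟩
  obtain ⟨g, A, hg, hAg, hA⟩ := Waz.exists_seq (N := N)
  refine ⟨Waz.X N, inferInstance, Waz.isWazewski, Waz.GG g, Waz.GG_fg g, Waz.dense_GG g hg, ?_, ?_⟩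
  · intro H hH
    have e : H ≃* H.map (Waz.GG g).subtype :=
      H.equivMapOfInjective _ (Waz.GG g).subtype_injective
    have : Finite H := hH
    have : Finite (H.map (Waz.GG g).subtype) := Finite.of_equiv _ e.toEquiv
    rw [Nat.card_congr e.toEquiv]
    exact ⟨Waz.finite_part1 _, Waz.finite_part2 _⟩
  · intro m hm hs hn'
    obtain ⟨K, hK1, hK2, hK3⟩ := Waz.exists_abelian_G hAg hA m hm hs hn'
    refine ⟨K.subgroupOf (Waz.GG g), ?_, ?_⟩
    · rw [← hK2]
      exact Nat.card_congr (Subgroup.subgroupOfEquivOfLe hK1).toEquiv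
    · intro x hx y hy
      exact Subtype.ext (hK3 _ hx _ hy)
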